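/- arXiv:1305.2141 — 9 statements merged into one kernel-verified Lean document; each statement's English description precedes it below -/
import Mathlib

section
/- Let n, m, h be positive integers with m ≤ n. For any finite abelian group G of order n, the minimum size of the h-fold sumset over all m-element subsets equals u(n,m,h); that is, ρ(G,m,h) = u(n,m,h). -/
open Finset

/-- The `h`-fold sumset of `A`: all sums of `h` not-necessarily-distinct elements of `A`. -/
def hFoldSum {G : Type*} [AddCommMonoid G] [DecidableEq G] (h : ℕ) (A : Finset G) : Finset G :=
  (Fintype.piFinset fun _ : Fin h => A).image fun f => ∑ i, f i

/-- The `h`-fold restricted sumset of `A`: all sums of `h` pairwise distinct elements of `A`. -/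
def hFoldRSum {G : Type*} [AddCommMonoid G] [DecidableEq G] (h : ℕ) (A : Finset G) : Finset G :=
  (A.powersetCard h).image fun s => ∑ x ∈ s, x

/-- `ρ(G,m,h)`: minimum size of the `h`-fold sumset over `m`-element subsets of `G`. -/
noncomputable def rho (G : Type*) [AddCommMonoid G] [DecidableEq G] (m h : ℕ) : ℕ :=
  sInf { k | ∃ A : Finset G, A.card = m ∧ (hFoldSum h A).card = k }

/-- `ρ^(G,m,h)`: minimum size of the `h`-fold restricted sumset over `m`-element subsets. -/
noncomputable def rhoHat (G : Type*) [AddCommMonoid G] [DecidableEq G] (m h : ℕ) : ℕ :=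
  sInf { k | ∃ A : Finset G, A.card = m ∧ (hFoldRSum h A).card = k }

/-- `f_d = (h⌈m/d⌉ - h + 1) d`. -/
def fd (m h d : ℕ) : ℕ := (h * ((m + d - 1) / d) - h + 1) * d

/-- `u(n,m,h) = min { f_d : d ∣ n, d > 0 }`. -/
noncomputable def uFun (n m h : ℕ) : ℕ := sInf { k | ∃ d : ℕ, d ∣ n ∧ 0 < d ∧ k = fd m h d }

/-- The set `A_d(n,m) ⊆ ℤ_n`, with `c = ⌈m/d⌉ - 1`, `k = m - cd`,
`H = {j·(n/d) : j = 0,…,d-1}`:  `A_d(n,m) = ⋃_{i<c} (i+H) ∪ {c + j·(n/d) : j < k}`. -/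
def Aset (n m d : ℕ) : Finset (ZMod n) :=
  ((Finset.range ((m + d - 1) / d - 1)) ×ˢ (Finset.range d)).image
    (fun p => (p.1 : ZMod n) + (p.2 : ZMod n) * ((n / d : ℕ) : ZMod n)) ∪
  (Finset.range (m - ((m + d - 1) / d - 1) * d)).image
    (fun j : ℕ => (((m + d - 1) / d - 1 : ℕ) : ZMod n) + (j : ZMod n) * ((n / d : ℕ) : ZMod n))

/-- The set `B_d(n,m;k₁,k₂,g,j₀)` (with `c` such that `m = k₁ + (c-1)d + k₂`):
`{j·(n/d) : j < k₁} ∪ ⋃_{1 ≤ i ≤ c-1} (i·g + H) ∪ {c·g + (j₀+j)·(n/d) : j < k₂}`. -/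
def Bset (n d k₁ k₂ c j₀ : ℕ) (g : ZMod n) : Finset (ZMod n) :=
  (Finset.range k₁).image (fun j : ℕ => (j : ZMod n) * ((n / d : ℕ) : ZMod n)) ∪
  ((Finset.Ico 1 c) ×ˢ (Finset.range d)).image
    (fun p => p.1 • g + (p.2 : ZMod n) * ((n / d : ℕ) : ZMod n)) ∪
  (Finset.range k₂).image
    (fun j => c • g + ((j₀ + j : ℕ) : ZMod n) * ((n / d : ℕ) : ZMod n))

section Kneser
set_option linter.unusedSectionVars false
variable {G : Type*} [AddCommGroup G] [Fintype G] [DecidableEq G]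

def stF (C : Finset G) : Finset G := univ.filter fun g => ∀ x, g + x ∈ C ↔ x ∈ C

theorem mem_stF {C : Finset G} {g : G} : g ∈ stF C ↔ ∀ x, g + x ∈ C ↔ x ∈ C := by
  simp [stF]

def stG (C : Finset G) : AddSubgroup G where
  carrier := {g | ∀ x, g + x ∈ C ↔ x ∈ C}
  zero_mem' := by intro x; simp
  add_mem' := by
    intro a b ha hb x
    rw [add_assoc, ha, hb]
  neg_mem' := by
    intro a ha x
    have := ha (-a + x)
    simpa using this.symm

theorem mem_stG {C : Finset G} {g : G} : g ∈ stG C ↔ ∀ x, g + x ∈ C ↔ x ∈ C := Iff.rfl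

theorem mem_stF_iff {C : Finset G} {g : G} : g ∈ stF C ↔ g ∈ stG C := by
  rw [mem_stF, mem_stG]

theorem card_stG (C : Finset G) : Nat.card (stG C) = #(stF C) := by
  have : ((stF C : Finset G) : Set G) = (stG C : Set G) := by
    ext x; simp [mem_stF_iff]
  rw [← Set.ncard_coe_finset, this]; rfl

/-- invariant nonempty set has at least as many elements -/
theorem card_le_of_inv (D S : Finset G) (hS : S.Nonempty)
    (hinv : ∀ g ∈ D, ∀ x ∈ S, g + x ∈ S) : #D ≤ #S := by
  obtain ⟨x, hx⟩ := hS
  apply Finset.card_le_card_of_injOn (fun g => g + x)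
  · intro g hg; exact hinv g hg x hx
  · intro a _ b _ hab; simpa using hab

theorem prod_card_le (H1 H2 : AddSubgroup G) (D S T U : Finset G) (c : G)
    (hD : ∀ x, x ∈ H1 → x ∈ H2 → x ∈ D)
    (hS : ∀ x ∈ S, x ∈ H2) (hT : ∀ x ∈ T, x ∈ H1)
    (hU : ∀ x ∈ S, ∀ y ∈ T, c + x + y ∈ U) : #S * #T ≤ #D * #U := by
  rw [← Finset.card_product]
  have h1 := Finset.card_le_mul_card_image (f := fun p : G × G => c + p.1 + p.2) (S ×ˢ T) (#D) ?_
  · refine h1.trans (Nat.mul_le_mul_left _ (Finset.card_le_card ?_))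
    intro z hz
    simp only [mem_image, mem_product, Prod.exists] at hz
    obtain ⟨x, y, ⟨hx, hy⟩, rfl⟩ := hz
    exact hU x hx y hy
  · intro z hz
    simp only [mem_image, mem_product, Prod.exists] at hz
    obtain ⟨x, y, ⟨hx, hy⟩, rfl⟩ := hz
    apply Finset.card_le_card_of_injOn (fun p : G × G => p.1 - x)
    · rintro ⟨a, b⟩ hp
      simp only [coe_filter, mem_product, Set.mem_ofPred_eq] at hp
      obtain ⟨⟨ha, hb⟩, he⟩ := hp
      have e2 : a - x = y - b := by
        rw [add_assoc, add_assoc] at he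
        have := add_left_cancel he
        rw [sub_eq_sub_iff_add_eq_add, this, add_comm]
      apply hD
      · show a - x ∈ H1
        rw [e2]; exact H1.sub_mem (hT _ hy) (hT _ hb)
      · exact H2.sub_mem (hS _ ha) (hS _ hx)
    · rintro ⟨a, b⟩ hp ⟨a', b'⟩ hp' he
      simp only [coe_filter, mem_product, Set.mem_ofPred_eq] at hp hp'
      have h3 : a = a' := by simpa using he
      subst h3
      have := hp.2.trans hp'.2.symm
      simpa using this

theorem union_half (C1 C2 : Finset G) (hne : ¬ C1 ⊆ C2) (hc : #(stF C2) ≤ #(stF C1)) :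
    #C1 + #(stF C1) ≤ #(C1 ∪ C2) + #(stF (C1 ∪ C2)) ∨
    #C2 + #(stF C2) ≤ #(C1 ∪ C2) + #(stF (C1 ∪ C2)) := by
  obtain ⟨c, hc1, hc2⟩ := Finset.not_subset.1 hne
  set D := stF C1 ∩ stF C2 with hDdef
  have hDle : #D ≤ #(stF (C1 ∪ C2)) := by
    apply Finset.card_le_card
    intro g hg
    rw [hDdef, mem_inter, mem_stF, mem_stF] at hg
    rw [mem_stF]; intro x; simp [hg.1 x, hg.2 x]
  have hDpos : 0 < #D := Finset.card_pos.2 ⟨0, by simp [hDdef, mem_stF]⟩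
  set S := (stF C2).filter (fun x => c + x ∉ C1) with hS
  set S' := (stF C2).filter (fun x => ¬ (c + x ∉ C1)) with hS'
  set T := (stF C1).filter (fun x => c + x ∉ C2) with hT
  set T' := (stF C1).filter (fun x => ¬ (c + x ∉ C2)) with hT'
  have hSS : #S + #S' = #(stF C2) := Finset.card_filter_add_card_filter_not _
  have hTT : #T + #T' = #(stF C1) := Finset.card_filter_add_card_filter_not _
  have in1 : ∀ g ∈ D, ∀ x, (c + (g + x) ∈ C1 ↔ c + x ∈ C1) := by
    intro g hg x
    rw [hDdef, mem_inter, mem_stF] at hg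
    rw [add_left_comm]; exact hg.1 _
  have in2 : ∀ g ∈ D, ∀ x, (c + (g + x) ∈ C2 ↔ c + x ∈ C2) := by
    intro g hg x
    rw [hDdef, mem_inter, mem_stF, mem_stF] at hg
    rw [add_left_comm]; exact hg.2 _
  have D1 : ∀ g ∈ D, ∀ x ∈ stF C1, g + x ∈ stF C1 := by
    intro g hg x hx
    rw [hDdef, mem_inter] at hg
    rw [mem_stF_iff] at hx ⊢
    exact (stG C1).add_mem (mem_stF_iff.1 hg.1) hx
  have D2 : ∀ g ∈ D, ∀ x ∈ stF C2, g + x ∈ stF C2 := by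
    intro g hg x hx
    rw [hDdef, mem_inter] at hg
    rw [mem_stF_iff] at hx ⊢
    exact (stG C2).add_mem (mem_stF_iff.1 hg.2) hx
  have bS : 0 < #S → #D ≤ #S := fun h => card_le_of_inv D S (Finset.card_pos.1 h) (by
    intro g hg x hx
    rw [hS, mem_filter] at *
    exact ⟨D2 g hg x hx.1, by rw [in1 g hg]; exact hx.2⟩)
  have bS' : #D ≤ #S' := card_le_of_inv D S' ⟨0, by simp [hS', hc1, mem_stF]⟩ (by
    intro g hg x hx
    rw [hS', mem_filter] at *
    exact ⟨D2 g hg x hx.1, by rw [in1 g hg]; exact hx.2⟩)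
  have bT : #D ≤ #T := card_le_of_inv D T ⟨0, by simp [hT, hc2, mem_stF]⟩ (by
    intro g hg x hx
    rw [hT, mem_filter] at *
    exact ⟨D1 g hg x hx.1, by rw [in2 g hg]; exact hx.2⟩)
  have bT' : 0 < #T' → #D ≤ #T' := fun h => card_le_of_inv D T' (Finset.card_pos.1 h) (by
    intro g hg x hx
    rw [hT', mem_filter] at *
    exact ⟨D1 g hg x hx.1, by rw [in2 g hg]; exact hx.2⟩)
  have hDm : ∀ x, x ∈ stG C1 → x ∈ stG C2 → x ∈ D := by
    intro x h1 h2
    rw [hDdef, mem_inter, mem_stF_iff, mem_stF_iff]; exact ⟨h1, h2⟩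
  have k1 : #S * #T' ≤ #D * #(C2 \ C1) := by
    apply prod_card_le (stG C1) (stG C2) D S T' _ c hDm
    · intro x hx; exact mem_stF_iff.1 (mem_filter.1 hx).1
    · intro x hx; exact mem_stF_iff.1 (mem_filter.1 hx).1
    · intro x hx y hy
      rw [hS, mem_filter, mem_stF] at hx
      rw [hT', mem_filter, mem_stF, not_not] at hy
      rw [mem_sdiff]
      constructor
      · rw [add_right_comm, add_comm, hx.1]; exact hy.2
      · rw [add_comm, hy.1]; exact hx.2
  have k2 : #S' * #T ≤ #D * #(C1 \ C2) := by
    apply prod_card_le (stG C1) (stG C2) D S' T _ c hDm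
    · intro x hx; exact mem_stF_iff.1 (mem_filter.1 hx).1
    · intro x hx; exact mem_stF_iff.1 (mem_filter.1 hx).1
    · intro x hx y hy
      rw [hS', mem_filter, mem_stF, not_not] at hx
      rw [hT, mem_filter, mem_stF] at hy
      rw [mem_sdiff]
      constructor
      · rw [add_comm, hy.1]; exact hx.2
      · rw [add_right_comm, add_comm, hx.1]; exact hy.2
  have c1 : #(C1 ∪ C2) = #(C2 \ C1) + #C1 := by
    rw [Finset.card_sdiff_add_card C2 C1, union_comm]
  have c2 : #(C1 ∪ C2) = #(C1 \ C2) + #C2 := by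
    rw [Finset.card_sdiff_add_card C1 C2]
  suffices #(stF C1) ≤ #(C2 \ C1) + #D ∨ #(stF C2) ≤ #(C1 \ C2) + #D by omega
  rw [← hSS, ← hTT] at hc ⊢
  generalize #S = s at *
  generalize #S' = s' at *
  generalize #T = t at *
  generalize #T' = t' at *
  generalize #D = d at *
  generalize #(C2 \ C1) = x at *
  generalize #(C1 \ C2) = y at *
  clear c1 c2
  rcases Nat.eq_zero_or_pos s with h0 | h0
  · right
    have : d * s' ≤ d * y := by nlinarith
    have := Nat.le_of_mul_le_mul_left this hDpos
    omega
  rcases Nat.eq_zero_or_pos t' with h1 | h1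
  · right
    have : d * t ≤ d * y := by nlinarith
    have := Nat.le_of_mul_le_mul_left this hDpos
    omega
  have bS := bS h0
  have bT' := bT' h1
  rcases le_total t s with h2 | h2
  · left
    have : d * (t + t') ≤ d * (x + d) := by
      obtain ⟨a, rfl⟩ := Nat.exists_eq_add_of_le bT
      obtain ⟨b, rfl⟩ := Nat.exists_eq_add_of_le h2
      obtain ⟨e, rfl⟩ := Nat.exists_eq_add_of_le bT'
      nlinarith [Nat.zero_le (a*e), Nat.zero_le (b*d), Nat.zero_le (b*e)]
    exact Nat.le_of_mul_le_mul_left this hDpos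
  · right
    have : d * (s + s') ≤ d * (y + d) := by
      obtain ⟨a, rfl⟩ := Nat.exists_eq_add_of_le bS
      obtain ⟨b, rfl⟩ := Nat.exists_eq_add_of_le h2
      obtain ⟨e, rfl⟩ := Nat.exists_eq_add_of_le bS'
      nlinarith [Nat.zero_le (a*e), Nat.zero_le (b*d), Nat.zero_le (b*e)]
    exact Nat.le_of_mul_le_mul_left this hDpos

theorem union_two (C1 C2 : Finset G) (N : ℕ) (h1 : N ≤ #C1 + #(stF C1))
    (h2 : N ≤ #C2 + #(stF C2)) : N ≤ #(C1 ∪ C2) + #(stF (C1 ∪ C2)) := by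
  by_cases s1 : C1 ⊆ C2
  · rwa [union_eq_right.2 s1]
  by_cases s2 : C2 ⊆ C1
  · rwa [union_eq_left.2 s2]
  rcases le_total (#(stF C2)) (#(stF C1)) with h | h
  · rcases union_half C1 C2 s1 h with h | h <;> omega
  · rw [union_comm]
    rcases union_half C2 C1 s2 h with h | h <;> omega

open scoped Pointwise

theorem local_piece (A B C : Finset G) (a b : G) (ha : a ∈ A) (hb : b ∈ B) (hC : A + B ⊆ C) :
    ∃ U, a + b ∈ U ∧ U ⊆ C ∧ #A + #B ≤ #U + #(stF U) := by
  induction hk : #(univ \ A) using Nat.strong_induction_on generalizing A B with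
  | _ k ih =>
  by_cases hst : ∀ x ∈ A, ∀ y ∈ B, x + (y - b) ∈ A
  · refine ⟨A.image (· + b), mem_image_of_mem _ ha, ?_, ?_⟩
    · intro z hz
      obtain ⟨x, hx, rfl⟩ := mem_image.1 hz
      exact hC (add_mem_add hx hb)
    · rw [Finset.card_image_of_injective _ (add_left_injective b)]
      apply Nat.add_le_add_left
      apply Finset.card_le_card_of_injOn (fun y => y - b)
      · intro y hy
        have himg : A.image (fun x => x + (y - b)) = A := by
          apply Finset.eq_of_subset_of_card_le
          · intro z hz
            obtain ⟨x, hx, rfl⟩ := mem_image.1 hz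
            exact hst x hx y hy
          · rw [Finset.card_image_of_injective _ (add_left_injective _)]
        simp only [mem_coe]
        rw [mem_stF]
        intro z
        have h1 : ∀ w, w ∈ A.image (· + b) ↔ w - b ∈ A := by
          intro w
          rw [mem_image]
          constructor
          · rintro ⟨x, hx, rfl⟩; simpa using hx
          · intro h; exact ⟨_, h, by simp⟩
        rw [h1, h1]
        constructor
        · intro h
          rw [← himg, mem_image] at h
          obtain ⟨x, hx, he⟩ := h
          have : x = z - b := by
            have : x + (y - b) = (z - b) + (y - b) := by rw [he]; abel
            exact add_right_cancel this
          rwa [← this]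
        · intro h
          have := hst _ h y hy
          have e : y - b + z - b = z - b + (y - b) := by abel
          rwa [e]
      · intro x _ y _ h; simpa using h
  · push Not at hst
    obtain ⟨x, hx, y, hy, hxy⟩ := hst
    set e := x - b with he
    have key : #(A ∪ B.image (e + ·)) + #(B.filter (fun z => e + z ∈ A)) = #A + #B := by
      have h1 := Finset.card_union_add_card_inter A (B.image (e + ·))
      rw [Finset.card_image_of_injective _ (add_right_injective e)] at h1
      rw [← h1]
      congr 1
      rw [← Finset.card_image_of_injective (B.filter _) (add_right_injective e)]
      congr 1
      ext z
      simp only [mem_image, mem_filter, mem_inter]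
      constructor
      · rintro ⟨w, ⟨h1, h2⟩, rfl⟩; exact ⟨h2, w, h1, rfl⟩
      · rintro ⟨h2, w, h1, rfl⟩; exact ⟨w, ⟨h1, h2⟩, rfl⟩
    rw [← key]
    refine ih _ ?_ _ _ (mem_union_left _ ha) ?_ ?_ rfl
    · rw [← hk]
      apply Finset.card_lt_card
      rw [Finset.ssubset_iff_of_subset (Finset.sdiff_subset_sdiff le_rfl subset_union_left)]
      refine ⟨x + (y - b), by simp [hxy], ?_⟩
      simp only [mem_sdiff, mem_univ, true_and, not_not]
      apply mem_union_right
      exact mem_image.2 ⟨y, hy, by rw [he]; abel⟩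
    · rw [mem_filter]; exact ⟨hb, by rw [he]; simpa using hx⟩
    · intro z hz
      obtain ⟨u, hu, v, hv, rfl⟩ := mem_add.1 hz
      rw [mem_filter] at hv
      rcases mem_union.1 hu with hu | hu
      · exact hC (add_mem_add hu hv.1)
      · obtain ⟨w, hw, rfl⟩ := mem_image.1 hu
        have : e + w + v = (e + v) + w := by abel
        rw [this]
        exact hC (add_mem_add hv.2 hw)

theorem kneser_weak (A B : Finset G) (hA : A.Nonempty) (hB : B.Nonempty) :
    #A + #B ≤ #(A + B) + #(stF (A + B)) := by
  have main : ∀ S : Finset G, S.Nonempty → S ⊆ A + B →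
      ∃ U, S ⊆ U ∧ U ⊆ A + B ∧ #A + #B ≤ #U + #(stF U) := by
    intro S hS
    induction hS using Finset.Nonempty.cons_induction with
    | singleton c =>
      intro h
      obtain ⟨a, ha, b, hb, rfl⟩ := mem_add.1 (h (mem_singleton_self _))
      obtain ⟨U, h1, h2, h3⟩ := local_piece A B (A + B) a b ha hb le_rfl
      exact ⟨U, by simpa using h1, h2, h3⟩
    | cons c s hc hs ih =>
      intro h
      rw [cons_eq_insert] at *
      obtain ⟨V, v1, v2, v3⟩ := ih ((subset_insert _ _).trans h)
      obtain ⟨a, ha, b, hb, rfl⟩ := mem_add.1 (h (mem_insert_self _ _))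
      obtain ⟨U, h1, h2, h3⟩ := local_piece A B (A + B) a b ha hb le_rfl
      refine ⟨U ∪ V, ?_, union_subset h2 v2, union_two _ _ _ h3 v3⟩
      exact insert_subset (mem_union_left _ h1) (v1.trans subset_union_right)
  obtain ⟨U, h1, h2, h3⟩ := main _ (hA.add hB) le_rfl
  rwa [subset_antisymm h2 h1] at h3

theorem hFoldSum_eq (h : ℕ) (A : Finset G) : hFoldSum h A = h • A := by
  induction h with
  | zero => ext x; simp [hFoldSum, eq_comm]
  | succ h ih =>
    rw [succ_nsmul', ← ih]
    ext x
    simp only [hFoldSum, mem_add, mem_image, Fintype.mem_piFinset]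
    constructor
    · rintro ⟨f, hf, rfl⟩
      exact ⟨f 0, hf 0, _, ⟨fun i => f i.succ, fun i => hf _, rfl⟩, by rw [Fin.sum_univ_succ]⟩
    · rintro ⟨a, ha, _, ⟨f, hf, rfl⟩, rfl⟩
      refine ⟨Fin.cons a f, ?_, by simp [Fin.sum_univ_succ]⟩
      intro i
      refine Fin.cases ?_ ?_ i
      · simpa using ha
      · intro j; simpa using hf j

theorem stF_add (A B : Finset G) : stF A ⊆ stF (A + B) := by
  intro g hg
  have key : ∀ g ∈ stG A, ∀ x ∈ A + B, g + x ∈ A + B := by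
    intro g hg x hx
    obtain ⟨a, ha, b, hb, rfl⟩ := mem_add.1 hx
    rw [← add_assoc]
    exact add_mem_add ((hg a).2 ha) hb
  rw [mem_stF_iff] at hg
  rw [mem_stF]
  intro x
  refine ⟨fun h => ?_, key g hg x⟩
  simpa using key _ ((stG A).neg_mem hg) _ h

theorem dvd_card_inv (C A : Finset G) (hA : ∀ g ∈ stG C, ∀ x ∈ A, g + x ∈ A) :
    #(stF C) ∣ #A := by
  classical
  rw [Finset.card_eq_sum_card_image (QuotientAddGroup.mk : G → G ⧸ stG C) A]
  apply Finset.dvd_sum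
  intro q hq
  obtain ⟨a, ha, rfl⟩ := mem_image.1 hq
  apply dvd_of_eq
  symm
  have : A.filter (fun x : G => (x : G ⧸ stG C) = a) = (stF C).image (fun g => g + a) := by
    ext x
    rw [mem_filter, mem_image]
    constructor
    · rintro ⟨hx, h⟩
      refine ⟨x - a, ?_, by simp⟩
      rw [mem_stF_iff]
      have := QuotientAddGroup.eq.1 h.symm
      rwa [neg_add_eq_sub] at this
    · rintro ⟨g, hg, rfl⟩
      rw [mem_stF_iff] at hg
      refine ⟨hA g hg a ha, ?_⟩
      symm
      rw [QuotientAddGroup.eq]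
      simpa using hg
  rw [this, Finset.card_image_of_injective _ (add_left_injective a)]

theorem lower (m h : ℕ) (hm : 0 < m) (hh : 0 < h) (A : Finset G) (hA : #A = m) :
    ∃ d, d ∣ Fintype.card G ∧ 0 < d ∧ fd m h d ≤ #(hFoldSum h A) := by
  rw [hFoldSum_eq]
  set C := h • A with hC
  have hAne : A.Nonempty := Finset.card_pos.1 (by omega)
  set d := #(stF C) with hd
  have h0 : (0 : G) ∈ stF C := by simp [mem_stF]
  have hdpos : 0 < d := Finset.card_pos.2 ⟨0, h0⟩
  refine ⟨d, ?_, hdpos, ?_⟩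
  · rw [hd, ← card_stG, ← Nat.card_eq_fintype_card]
    exact AddSubgroup.card_addSubgroup_dvd_card _
  set A' := A + stF C with hA'
  have hsub : A ⊆ A' := fun x hx => by
    rw [hA', mem_add]; exact ⟨x, hx, 0, h0, by simp⟩
  have hne : A'.Nonempty := hAne.mono hsub
  have hdv : d ∣ #A' := by
    apply dvd_card_inv
    intro g hg x hx
    obtain ⟨a, ha, b, hb, rfl⟩ := mem_add.1 hx
    rw [add_left_comm]
    refine add_mem_add ha ?_
    rw [mem_stF_iff] at *
    exact (stG C).add_mem hg hb
  have hst : ∀ k : ℕ, k • stF C ⊆ stF C := by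
    intro k
    induction k with
    | zero => intro x hx; simp at hx; rwa [hx]
    | succ k ih =>
      rw [succ_nsmul]
      intro x hx
      obtain ⟨a, ha, b, hb, rfl⟩ := mem_add.1 hx
      rw [mem_stF_iff]
      exact (stG C).add_mem (mem_stF_iff.1 (ih ha)) (mem_stF_iff.1 hb)
  have hCA : h • A' = C := by
    apply subset_antisymm
    · rw [hA', nsmul_add]
      intro x hx
      obtain ⟨a, ha, b, hb, rfl⟩ := mem_add.1 hx
      rw [add_comm]
      exact (mem_stF.1 (hst _ hb) a).2 ha
    · exact Finset.nsmul_subset_nsmul_left hsub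
  have ind : ∀ j : ℕ, 1 ≤ j → j ≤ h → j * #A' ≤ #(j • A') + (j - 1) * d := by
    intro j hj
    induction j, hj using Nat.le_induction with
    | base => intro; simp
    | succ j hj ih =>
      intro hjh
      have ih := ih (by omega)
      have k := kneser_weak (j • A') A' hne.nsmul hne
      rw [← succ_nsmul] at k
      have : #(stF ((j+1) • A')) ≤ d := by
        rw [hd, ← hCA]
        apply Finset.card_le_card
        have : h = (j + 1) + (h - (j+1)) := by omega
        conv_rhs => rw [this, add_nsmul]
        exact stF_add _ _
      obtain ⟨i, rfl⟩ := Nat.exists_eq_add_of_le hj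
      simp only [Nat.add_sub_cancel, Nat.add_sub_cancel_left] at *
      nlinarith
  have fin := ind h hh le_rfl
  rw [hCA] at fin
  obtain ⟨q, hq⟩ := hdv
  have hmq : m ≤ d * q := by rw [← hq, ← hA]; exact Finset.card_le_card hsub
  have hceil : (m + d - 1) / d ≤ q := by
    rw [← Nat.lt_succ_iff, Nat.div_lt_iff_lt_mul hdpos]
    rw [Nat.succ_mul, mul_comm q d]; omega
  have hq1 : 1 ≤ q := by
    rcases Nat.eq_zero_or_pos q with h | h
    · subst h; omega
    · exact h
  unfold fd
  calc (h * ((m + d - 1) / d) - h + 1) * d ≤ (h * q - h + 1) * d := by gcongr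
    _ ≤ #C := by
      rw [hq] at fin
      obtain ⟨r, rfl⟩ := Nat.exists_eq_add_of_le hq1
      obtain ⟨i, rfl⟩ := Nat.exists_eq_add_of_le hh
      have : (0 + 1 + i) * (1 + r) - (0 + 1 + i) = (1 + i) * r := by
        rw [mul_add, mul_one, Nat.add_sub_cancel_left, zero_add]
      simp only [Nat.succ_eq_add_one] at *
      rw [this]
      simp only [zero_add, Nat.add_sub_cancel_left] at fin
      nlinarith
end Kneser

section Upper
universe u

theorem exists_subadd (G : Type u) [AddCommGroup G] [Fintype G] :
    ∃ φ : G → ℕ, Function.Injective φ ∧ (∀ x, φ x < Fintype.card G) ∧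
      ∀ x y, φ (x + y) ≤ φ x + φ y := by
  classical
  obtain ⟨ι, hι, n, hn, ⟨e⟩⟩ := AddCommGroup.equiv_directSum_zmod_of_finite' G
  have hn0 : ∀ i, NeZero (n i) := fun i => ⟨by have := hn i; omega⟩
  let e2 : G ≃+ ((i : ι) → ZMod (n i)) := e.trans (DirectSum.addEquivProd _)
  let k := Fintype.card ι
  let r : Fin k ≃ ι := (Fintype.equivFin ι).symm
  let n' : Fin k → ℕ := fun i => n (r i)
  let g : G → (i : Fin k) → Fin (n' i) := fun x i => ⟨(e2 x (r i)).val, ZMod.val_lt _⟩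
  have ginj : Function.Injective g := by
    intro x y hxy
    apply e2.injective
    funext i
    obtain ⟨j, rfl⟩ := r.surjective i
    have := congrArg Fin.val (congrFun hxy j)
    exact ZMod.val_injective _ this
  have hcard : Fintype.card G = ∏ i, n' i := by
    rw [Fintype.card_congr e2.toEquiv, Fintype.card_pi]
    simp only [ZMod.card]
    exact (Equiv.prod_comp r n).symm
  refine ⟨fun x => (finPiFinEquiv (g x) : ℕ), ?_, ?_, ?_⟩
  · intro x y h
    exact ginj (finPiFinEquiv.injective (Fin.ext h))
  · intro x
    rw [hcard]
    exact (finPiFinEquiv (g x)).2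
  · intro x y
    simp only [finPiFinEquiv_apply]
    rw [← Finset.sum_add_distrib]
    apply Finset.sum_le_sum
    intro i _
    rw [← add_mul]
    apply Nat.mul_le_mul_right
    show (e2 (x + y) (r i)).val ≤ (e2 x (r i)).val + (e2 y (r i)).val
    rw [map_add]
    exact ZMod.val_add_le _ _

theorem exists_layer (d : ℕ) : ∀ (G : Type u) [AddCommGroup G] [Fintype G], ∀ q,
    Fintype.card G = d * q → 
    ∃ φ : G → ℕ, (∀ k, #(univ.filter fun x => φ x = k) ≤ d) ∧ (∀ x, φ x < q) ∧
      ∀ x y, φ (x + y) ≤ φ x + φ y := by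
  classical
  induction d using induction_on_primes with
  | zero =>
    intro G _ _ q h
    have : 0 < Fintype.card G := Fintype.card_pos
    omega
  | one =>
    intro G _ _ q h
    obtain ⟨φ, h1, h2, h3⟩ := exists_subadd G
    refine ⟨φ, ?_, fun x => by have := h2 x; omega, h3⟩
    intro k
    rw [Finset.card_le_one]
    intro a ha b hb
    simp only [mem_filter, mem_univ, true_and] at ha hb
    exact h1 (ha.trans hb.symm)
  | prime_mul p a hp ih =>
    intro G _ _ q h
    have : Fact p.Prime := ⟨hp⟩
    obtain ⟨z, hz⟩ := exists_prime_addOrderOf_dvd_card (G := G) p ⟨a * q, by rw [h, mul_assoc]⟩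
    let K := AddSubgroup.zmultiples z
    have hK : Nat.card K = p := by rw [Nat.card_zmultiples, hz]
    have hq := AddSubgroup.card_eq_card_quotient_mul_card_addSubgroup K
    rw [hK, Nat.card_eq_fintype_card, Nat.card_eq_fintype_card, h] at hq
    have hQ : Fintype.card (G ⧸ K) = a * q := by
      apply Nat.eq_of_mul_eq_mul_left hp.pos
      rw [mul_comm, ← hq, mul_assoc]
    obtain ⟨φ, h1, h2, h3⟩ := ih (G ⧸ K) q hQ
    refine ⟨fun x => φ (QuotientAddGroup.mk x), ?_, fun x => h2 _, ?_⟩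
    · intro k
      have := Finset.card_le_mul_card_image (f := (QuotientAddGroup.mk : G → G ⧸ K))
        (univ.filter fun x : G => φ (QuotientAddGroup.mk x) = k) p ?_
      · refine this.trans (Nat.mul_le_mul_left _ (le_trans (Finset.card_le_card ?_) (h1 k)))
        intro y hy
        obtain ⟨x, hx, rfl⟩ := mem_image.1 hy
        simpa using hx
      · intro y hy
        obtain ⟨x, hx, rfl⟩ := mem_image.1 hy
        have hK' : #(univ.filter fun g : G => g ∈ K) = p := by
          rw [← hK, Nat.card_eq_fintype_card, Fintype.card_subtype]
        rw [← hK']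
        apply Finset.card_le_card_of_injOn (fun w => -x + w)
        · intro w hw
          simp only [coe_filter, mem_filter, mem_univ, true_and, Set.mem_ofPred_eq] at hw ⊢
          exact QuotientAddGroup.eq.1 hw.2.symm
        · intro u _ v _ huv; simpa using huv
    · intro x y
      exact h3 (QuotientAddGroup.mk x) (QuotientAddGroup.mk y)

theorem upper (G : Type u) [AddCommGroup G] [Fintype G] [DecidableEq G] (m h d : ℕ)
    (hm : 0 < m) (hmn : m ≤ Fintype.card G) (hd : d ∣ Fintype.card G) (hd0 : 0 < d) :
    ∃ A : Finset G, #A = m ∧ #(hFoldSum h A) ≤ fd m h d := by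
  obtain ⟨q, hq⟩ := hd
  obtain ⟨φ, h1, h2, h3⟩ := exists_layer d G q hq
  obtain ⟨c, hc⟩ : ∃ c, c = (m + d - 1) / d := ⟨_, rfl⟩
  have hmc : m ≤ d * c := by
    have := Nat.div_add_mod (m + d - 1) d
    have := Nat.mod_lt (m + d - 1) hd0
    rw [← hc] at *
    omega
  have hc1 : 1 ≤ c := by
    rcases Nat.eq_zero_or_pos c with h | h
    · subst h; omega
    · exact h
  have layer : ∀ (I : Finset ℕ), #(univ.filter fun x => φ x ∈ I) ≤ d * #I := by
    intro I
    apply Finset.card_le_mul_card_image_of_maps_to (f := φ)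
    · intro x hx; simpa using hx
    · intro k _
      refine (Finset.card_le_card ?_).trans (h1 k)
      intro x hx
      simp only [mem_filter, mem_univ, true_and] at hx ⊢
      exact hx.2
  have hbig : m ≤ #(univ.filter fun x => φ x < c) := by
    have l := layer (Finset.Ico c q)
    rw [Nat.card_Ico] at l
    have s := Finset.card_filter_add_card_filter_not (s := (univ : Finset G)) (fun x => φ x < c)
    have e : (univ.filter fun x => ¬ φ x < c) = univ.filter fun x => φ x ∈ Finset.Ico c q := by
      ext x
      have := h2 x
      simp [this]
    rw [e, Finset.card_univ, hq] at s
    rcases le_total c q with hcq | hcq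
    · rw [Nat.mul_sub] at l
      have := Nat.mul_le_mul_left d hcq
      omega
    · rw [Nat.sub_eq_zero_of_le hcq] at l
      omega
  obtain ⟨A, hA, hAm⟩ := Finset.exists_subset_card_eq hbig
  refine ⟨A, hAm, ?_⟩
  have hsum : ∀ k (f : Fin (k + 1) → G), (∀ i, f i ∈ A) → φ (∑ i, f i) ≤ (k + 1) * (c - 1) := by
    intro k
    induction k with
    | zero =>
      intro f hf
      have := hA (hf 0)
      simp only [mem_filter, mem_univ, true_and] at this
      simp; omega
    | succ k ih =>
      intro f hf
      rw [Fin.sum_univ_succ]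
      have a1 := h3 (f 0) (∑ i : Fin (k + 1), f i.succ)
      have a2 := ih (fun i => f i.succ) (fun i => hf _)
      have := hA (hf 0)
      simp only [mem_filter, mem_univ, true_and] at this
      have a3 : φ (f 0) ≤ c - 1 := by omega
      calc _ ≤ _ := a1
        _ ≤ (c - 1) + (k + 1) * (c - 1) := add_le_add a3 a2
        _ = _ := by ring
  unfold fd
  rw [← hc]
  rcases h with _ | k
  · have : #(hFoldSum 0 A) ≤ 1 := by simp [hFoldSum]
    simp; omega
  have l := layer (Finset.range ((k + 1) * (c - 1) + 1))
  rw [Finset.card_range, mul_comm d] at l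
  have : (k + 1) * c - (k + 1) = (k + 1) * (c - 1) := by rw [Nat.mul_sub, mul_one]
  rw [this]
  refine le_trans (Finset.card_le_card ?_) l
  intro x hx
  simp only [hFoldSum, mem_image, Fintype.mem_piFinset] at hx
  obtain ⟨f, hf, rfl⟩ := hx
  simp only [mem_filter, mem_univ, true_and, mem_range]
  have := hsum k f hf
  omega
end Upper

theorem stmt0 (n m h : ℕ) (hn : 0 < n) (hm : 0 < m) (hh : 0 < h) (hmn : m ≤ n)
    (G : Type*) [AddCommGroup G] [Fintype G] [DecidableEq G]
    (hG : Fintype.card G = n) :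
    rho G m h = uFun n m h := by
  subst hG
  apply le_antisymm
  · have hne : { k | ∃ d : ℕ, d ∣ Fintype.card G ∧ 0 < d ∧ k = fd m h d }.Nonempty :=
      ⟨_, 1, one_dvd _, one_pos, rfl⟩
    obtain ⟨d, hd, hd0, he⟩ := Nat.sInf_mem hne
    obtain ⟨A, hA, hle⟩ := upper G m h d hm hmn hd hd0
    unfold rho uFun
    rw [he]
    refine le_trans (Nat.sInf_le ?_) hle
    exact ⟨A, hA, rfl⟩
  · obtain ⟨A0, _, hA0⟩ := Finset.exists_subset_card_eq (s := (univ : Finset G)) hmn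
    have hne : { k | ∃ A : Finset G, A.card = m ∧ (hFoldSum h A).card = k }.Nonempty :=
      ⟨_, A0, hA0, rfl⟩
    obtain ⟨A, hA, he⟩ := Nat.sInf_mem hne
    obtain ⟨d, hd, hd0, hle⟩ := lower m h hm hh A hA
    unfold rho uFun
    rw [← he]
    refine le_trans (Nat.sInf_le ?_) hle
    exact ⟨d, hd, hd0, rfl⟩
end

section
/- Let n, m, h be positive integers with m ≤ n and let d be a positive divisor of n. Then the h-fold sumset of A_d(n,m) in Z_n has size |h A_d(n,m)| = min{n, f_d, hm − h + 1}, where f_d = (h·⌈m/d⌉ − h + 1)·d. -/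
open Finset

lemma hfs_zero {G : Type*} [AddCommMonoid G] [DecidableEq G] (A : Finset G) (x : G) :
    x ∈ hFoldSum 0 A ↔ x = 0 := by
  simp [hFoldSum, eq_comm]

lemma hfs_succ {G : Type*} [AddCommMonoid G] [DecidableEq G] (h : ℕ) (A : Finset G) (x : G) :
    x ∈ hFoldSum (h+1) A ↔ ∃ a ∈ A, ∃ b ∈ hFoldSum h A, x = a + b := by
  simp only [hFoldSum, mem_image, Fintype.mem_piFinset]
  constructor
  · rintro ⟨f, hf, rfl⟩
    exact ⟨f 0, hf 0, ∑ i : Fin h, f i.succ, ⟨fun i => f i.succ, fun i => hf _, rfl⟩,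
      Fin.sum_univ_succ f⟩
  · rintro ⟨a, ha, b, ⟨f, hf, rfl⟩, rfl⟩
    refine ⟨Fin.cons a f, fun i => ?_, ?_⟩
    · refine Fin.cases ?_ (fun i => ?_) i
      · simpa using ha
      · simpa using hf i
    · simp [Fin.sum_univ_succ]

lemma jmod (n d N : ℕ) (hnd : n = N * d) (j : ℕ) :
    ((j % d : ℕ) : ZMod n) * (N : ZMod n) = (j : ZMod n) * (N : ZMod n) := by
  have h1 : ((N * d : ℕ) : ZMod n) = 0 := by rw [← hnd]; simp
  conv_rhs => rw [← Nat.mod_add_div j d]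
  push_cast at h1 ⊢
  linear_combination (-((j / d : ℕ) : ZMod n)) * h1

lemma mem_hfs (n d N c k : ℕ) (A : Finset (ZMod n))
    (hA : ∀ x, x ∈ A ↔ ∃ i j : ℕ, (i < c ∨ i = c ∧ j ≤ k) ∧
      x = (i : ZMod n) + (j : ZMod n) * (N : ZMod n)) (h : ℕ) (x : ZMod n) :
    x ∈ hFoldSum h A ↔ ∃ i j : ℕ, (i < h * c ∨ i = h * c ∧ j ≤ h * k) ∧
      x = (i : ZMod n) + (j : ZMod n) * (N : ZMod n) := by
  induction h generalizing x with
  | zero =>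
    rw [hfs_zero]
    constructor
    · rintro rfl
      exact ⟨0, 0, by simp, by simp⟩
    · rintro ⟨i, j, hij, rfl⟩
      have : i = 0 ∧ j = 0 := by
        rcases hij with h | h <;> simp at h
        exact h
      simp [this.1, this.2]
  | succ h ih =>
    rw [hfs_succ]
    constructor
    · rintro ⟨a, ha, b, hb, rfl⟩
      obtain ⟨i, j, hij, rfl⟩ := (hA _).1 ha
      obtain ⟨i', j', hij', rfl⟩ := (ih _).1 hb
      refine ⟨i + i', j + j', ?_, by push_cast; ring⟩
      rw [Nat.succ_mul, Nat.succ_mul]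
      omega
    · rintro ⟨i, j, hij, rfl⟩
      rw [Nat.succ_mul, Nat.succ_mul] at hij
      have key : ∃ i1 j1 i2 j2, (i1 < c ∨ i1 = c ∧ j1 ≤ k) ∧
          (i2 < h * c ∨ i2 = h * c ∧ j2 ≤ h * k) ∧ i = i1 + i2 ∧ j = j1 + j2 := by
        rcases hij with h1 | ⟨h1, h2⟩
        · by_cases h3 : i < h * c
          · exact ⟨0, 0, i, j, by omega, by omega, by omega, by omega⟩
          · exact ⟨i - h * c, j, h * c, 0, by omega, by omega, by omega, by omega⟩
        · exact ⟨c, j - min j (h * k), h * c, min j (h * k), by omega, by omega, by omega, by omega⟩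
      obtain ⟨i1, j1, i2, j2, h1, h2, rfl, rfl⟩ := key
      exact ⟨_, (hA _).2 ⟨i1, j1, h1, rfl⟩, _, (ih _).2 ⟨i2, j2, h2, rfl⟩, by push_cast; ring⟩

lemma card_hfs (n d N a b : ℕ) (hN : 0 < N) (hd : 0 < d) (hnd : n = N * d)
    (S : Finset (ZMod n))
    (hS : ∀ x, x ∈ S ↔ ∃ i j : ℕ, (i < a ∨ i = a ∧ j ≤ b) ∧
      x = (i : ZMod n) + (j : ZMod n) * (N : ZMod n)) :
    S.card = min n (a * d + min d (b + 1)) := by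
  have hn : 0 < n := by rw [hnd]; positivity
  haveI : NeZero n := ⟨hn.ne'⟩
  by_cases hc : N ≤ a
  · have : S = univ := by
      ext x
      simp only [mem_univ, iff_true]
      rw [hS]
      refine ⟨x.val % N, x.val / N, Or.inl ((Nat.mod_lt _ hN).trans_le hc), ?_⟩
      have h1 := Nat.mod_add_div x.val N
      have h2 : ((x.val % N + N * (x.val / N) : ℕ) : ZMod n) = x := by
        rw [h1]; simp
      push_cast at h2
      rw [mul_comm] at h2
      exact h2.symm
    rw [this, card_univ, ZMod.card]
    have : N * d ≤ a * d := Nat.mul_le_mul_right _ hc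
    omega
  · push Not at hc
    have hS' : S = ((range a ×ˢ range d) ∪ ({a} ×ˢ range (min d (b + 1)))).image
        (fun p : ℕ × ℕ => (p.1 : ZMod n) + (p.2 : ZMod n) * (N : ZMod n)) := by
      ext x
      rw [hS, mem_image]
      constructor
      · rintro ⟨i, j, hij, rfl⟩
        refine ⟨(i, j % d), ?_, by simp only [jmod n d N hnd]⟩
        have h1 := Nat.mod_lt j hd
        have h2 := Nat.mod_le j d
        simp only [mem_union, mem_product, mem_range, mem_singleton]
        omega
      · rintro ⟨⟨i, j⟩, hij, rfl⟩
        refine ⟨i, j, ?_, rfl⟩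
        simp only [mem_union, mem_product, mem_range, mem_singleton] at hij
        omega
    rw [hS', card_image_of_injOn, card_union_of_disjoint]
    · simp only [card_product, card_range, card_singleton, one_mul]
      have : (a + 1) * d ≤ N * d := Nat.mul_le_mul_right _ hc
      rw [Nat.succ_mul] at this
      omega
    · rw [disjoint_left]
      rintro ⟨i, j⟩ h1 h2
      simp only [mem_product, mem_range, mem_singleton] at h1 h2
      omega
    · rintro ⟨i, j⟩ h1 ⟨i', j'⟩ h2 he
      simp only [coe_union, Set.mem_union, mem_coe, mem_product, mem_range, mem_singleton] at h1 h2
      have e1 : i < N ∧ j < d := by omega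
      have e2 : i' < N ∧ j' < d := by omega
      have lt : ∀ i j, i < N ∧ j < d → i + j * N < n := by
        intro i j h
        have : (j + 1) * N ≤ d * N := Nat.mul_le_mul_right _ h.2
        rw [Nat.succ_mul] at this
        rw [hnd, mul_comm N d]
        omega
      have he' : ((i + j * N : ℕ) : ZMod n) = ((i' + j' * N : ℕ) : ZMod n) := by
        push_cast; exact he
      rw [ZMod.natCast_eq_natCast_iff'] at he'
      rw [Nat.mod_eq_of_lt (lt _ _ e1), Nat.mod_eq_of_lt (lt _ _ e2)] at he'
      have hi : i = i' := by
        have := congrArg (· % N) he'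
        simpa [Nat.mod_eq_of_lt e1.1, Nat.mod_eq_of_lt e2.1] using this
      subst hi
      have : j * N = j' * N := by omega
      have := Nat.eq_of_mul_eq_mul_right hN this
      rw [this]

theorem stmt2 (n m h d : ℕ) (hn : 0 < n) (hm : 0 < m) (hh : 0 < h) (hmn : m ≤ n)
    (hd : 0 < d) (hdn : d ∣ n) :
    (hFoldSum h (Aset n m d)).card = min n (min (fd m h d) (h * m - h + 1)) := by
  have hnd : n = n / d * d := (Nat.div_mul_cancel hdn).symm
  have hN : 0 < n / d := Nat.div_pos (Nat.le_of_dvd hn hdn) hd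
  obtain ⟨c, hc⟩ : ∃ c, (m + d - 1) / d = c + 1 := by
    have : 0 < (m + d - 1) / d := Nat.div_pos (by omega) hd
    exact ⟨_, (Nat.succ_pred_eq_of_pos this).symm⟩
  obtain ⟨k, hk, hkd⟩ : ∃ k, m = c * d + (k + 1) ∧ k + 1 ≤ d := by
    have h1 := Nat.div_add_mod (m + d - 1) d
    have h2 := Nat.mod_lt (m + d - 1) hd
    rw [hc, mul_comm, Nat.succ_mul] at h1
    exact ⟨m - c * d - 1, by omega, by omega⟩
  have hA : ∀ x, x ∈ Aset n m d ↔ ∃ i j : ℕ, (i < c ∨ i = c ∧ j ≤ k) ∧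
      x = (i : ZMod n) + (j : ZMod n) * ((n / d : ℕ) : ZMod n) := by
    intro x
    have e1 : (m + d - 1) / d - 1 = c := by omega
    have e2 : m - c * d = k + 1 := by omega
    rw [Aset, e1, e2]
    simp only [mem_union, mem_image, mem_product, mem_range, Prod.exists]
    constructor
    · rintro (⟨i, j, h1, rfl⟩ | ⟨j, h1, rfl⟩)
      · exact ⟨i, j, Or.inl h1.1, rfl⟩
      · exact ⟨c, j, Or.inr ⟨rfl, by omega⟩, rfl⟩
    · rintro ⟨i, j, h1 | ⟨rfl, h1⟩, rfl⟩
      · exact Or.inl ⟨i, j % d, ⟨h1, Nat.mod_lt _ hd⟩, by rw [jmod n d _ hnd]⟩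
      · exact Or.inr ⟨j, by omega, rfl⟩
  rw [card_hfs n d (n / d) (h * c) (h * k) hN hd hnd _ (mem_hfs n d (n / d) c k _ hA h)]
  have f1 : fd m h d = h * c * d + d := by
    rw [fd, hc, Nat.mul_succ, Nat.add_sub_cancel, Nat.succ_mul]
  have f2 : h * m - h + 1 = h * c * d + (h * k + 1) := by
    have : h * m = h * c * d + h * k + h := by rw [hk]; ring
    omega
  rw [f1, f2]
  omega
end

section
/- Let m and n be positive integers such that m−1 is not a power of 2 and n is divisible by 2m−2, and let d be an odd divisor of m−1 with d > 1. Then the set B = B_d(n, m; (d+1)/2, (d+1)/2, n/(2m−2), (d−1)/2) is an m-element subset of Z_n whose 2-fold restricted sumset has size |2^B| = 2m − 4. -/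
open Finset

def FF (n q c i j : ℕ) : ZMod n := (((i + 2 * c * j) * q : ℕ) : ZMod n)

lemma FF_add (n q c i j i' j' : ℕ) : FF n q c i j + FF n q c i' j' = FF n q c (i + i') (j + j') := by
  simp only [FF]; push_cast; ring

lemma FF_carry (n q c i j : ℕ) : FF n q c (i + 2 * c) j = FF n q c i (j + 1) := by
  simp only [FF]; push_cast; ring

lemma FF_per (n q c d i j : ℕ) (h : n = 2 * c * d * q) : FF n q c i (j + d) = FF n q c i j := by
  have h0 : ((2 * c * d * q : ℕ) : ZMod n) = 0 := by rw [← h]; simp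
  simp only [FF]; push_cast at h0 ⊢; linear_combination h0

lemma FF_inj (n q c d i j i' j' : ℕ) (h : n = 2 * c * d * q) (hn : 0 < n)
    (hi : i < 2 * c) (hi' : i' < 2 * c) (hj : j < d) (hj' : j' < d)
    (e : FF n q c i j = FF n q c i' j') : i = i' ∧ j = j' := by
  have hq : 0 < q := by
    rcases Nat.eq_zero_or_pos q with h0 | h0
    · subst h0; simp at h; omega
    · exact h0
  have key : ∀ a b : ℕ, a < 2 * c → b < d → (a + 2 * c * b) * q < n := by
    intro a b ha hb
    rw [h]
    apply Nat.mul_lt_mul_of_pos_right _ hq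
    calc a + 2 * c * b < 2 * c + 2 * c * b := by omega
      _ = 2 * c * (b + 1) := by ring
      _ ≤ 2 * c * d := Nat.mul_le_mul_left _ hb
  simp only [FF] at e
  rw [ZMod.natCast_eq_natCast_iff', Nat.mod_eq_of_lt (key _ _ hi hj),
    Nat.mod_eq_of_lt (key _ _ hi' hj')] at e
  have e2 := Nat.eq_of_mul_eq_mul_right hq e
  have hc : 0 < 2 * c := by omega
  have a1 : i = i' := by
    have := congrArg (· % (2 * c)) e2
    simpa [Nat.add_mul_mod_self_left, Nat.mod_eq_of_lt hi, Nat.mod_eq_of_lt hi'] using this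
  refine ⟨a1, ?_⟩
  subst a1
  exact Nat.eq_of_mul_eq_mul_left hc (by omega)

def TT (c e : ℕ) : Finset (ℕ × ℕ) :=
  {0} ×ˢ Finset.range (e + 1) ∪ Finset.Ico 1 c ×ˢ Finset.range (2 * e + 1) ∪
    {c} ×ˢ Finset.Ico e (2 * e + 1)

lemma TT_card (c e : ℕ) (hc : 0 < c) : (TT c e).card = c * (2 * e + 1) + 1 := by
  unfold TT
  rw [Finset.card_union_of_disjoint, Finset.card_union_of_disjoint]
  · simp only [Finset.card_product, Finset.card_singleton, Finset.card_range, Nat.card_Ico]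
    obtain ⟨k, rfl⟩ : ∃ k, c = k + 1 := ⟨c - 1, by omega⟩
    have : 2 * e + 1 - e = e + 1 := by omega
    rw [this]; simp; ring
  · rw [Finset.disjoint_left]; rintro ⟨a, b⟩; simp; omega
  · rw [Finset.disjoint_left]; rintro ⟨a, b⟩; simp; omega

lemma mem_TT (c e i j : ℕ) : (i, j) ∈ TT c e ↔
    (i = 0 ∧ j ≤ e) ∨ (1 ≤ i ∧ i < c ∧ j ≤ 2 * e) ∨ (i = c ∧ e ≤ j ∧ j ≤ 2 * e) := by
  simp [TT]; omega

lemma Bset_eq (n q c e : ℕ) (h : n = 2 * c * (2 * e + 1) * q) :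
    Bset n (2 * e + 1) (e + 1) (e + 1) c e (q : ZMod n) =
      (TT c e).image (fun p => FF n q c p.1 p.2) := by
  have hd : n / (2 * e + 1) = 2 * c * q := by
    rw [h]; apply Nat.div_eq_of_eq_mul_left (by omega); ring
  have hF : ∀ i j : ℕ, FF n q c i j = i • (q : ZMod n) + (j : ZMod n) * ((2 * c * q : ℕ) : ZMod n) := by
    intro i j; simp only [FF, nsmul_eq_mul]; push_cast; ring
  have hI : (Finset.Ico e (2 * e + 1)) = (Finset.range (e + 1)).image (fun j => e + j) := by
    ext x; simp only [Finset.mem_Ico, Finset.mem_image, Finset.mem_range]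
    constructor
    · intro hx; exact ⟨x - e, by omega, by omega⟩
    · rintro ⟨y, hy, rfl⟩; omega
  unfold Bset TT
  rw [hd, Finset.image_union, Finset.image_union, hI]
  simp only [Finset.singleton_product, Finset.map_eq_image, Finset.image_image]
  congr 1
  · congr 1
    · apply Finset.image_congr; intro j _; simp [hF]
    · apply Finset.image_congr; intro j _; simp [hF]
  · apply Finset.image_congr; intro j _; simp [hF]

lemma mem_rsum {G : Type*} [AddCommMonoid G] [DecidableEq G] (A : Finset G) (x : G) :
    x ∈ hFoldRSum 2 A ↔ ∃ a ∈ A, ∃ b ∈ A, a ≠ b ∧ a + b = x := by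
  unfold hFoldRSum
  simp only [Finset.mem_image, Finset.mem_powersetCard]
  constructor
  · rintro ⟨s, ⟨hs, h2⟩, rfl⟩
    obtain ⟨a, b, hab, rfl⟩ := Finset.card_eq_two.1 h2
    exact ⟨a, hs (by simp), b, hs (by simp), hab, (Finset.sum_pair (f := fun y => y) hab).symm⟩
  · rintro ⟨a, ha, b, hb, hab, rfl⟩
    refine ⟨{a, b}, ⟨?_, Finset.card_pair hab⟩, Finset.sum_pair (f := fun y => y) hab⟩
    intro y hy; simp at hy; rcases hy with rfl | rfl <;> assumption

def UU (c e : ℕ) : Finset (ℕ × ℕ) :=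
  (Finset.range (2 * c) ×ˢ Finset.range (2 * e + 1)) \ {(0, 0), (0, 2 * e)}

lemma UU_card (c e : ℕ) (hc : 0 < c) (he : 0 < e) : (UU c e).card = 2 * c * (2 * e + 1) - 2 := by
  unfold UU
  rw [Finset.card_sdiff_of_subset]
  · rw [Finset.card_product, Finset.card_range, Finset.card_range, Finset.card_pair]
    simp; omega
  · intro x hx; simp at hx; rcases hx with rfl | rfl <;> simp <;> omega

lemma mem_UU (c e i j : ℕ) : (i, j) ∈ UU c e ↔
    i < 2 * c ∧ j ≤ 2 * e ∧ (i = 0 → 1 ≤ j ∧ j < 2 * e) := by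
  simp [UU]; omega

lemma FF_sum_mem (n q c e i j : ℕ) (h : n = 2 * c * (2 * e + 1) * q) (hc : 0 < c)
    (hi : i < 2 * c) (hij : i ≠ 0 ∨ (1 ≤ j ∧ j < 2 * e) ∨ (2 * e + 2 ≤ j ∧ j < 4 * e + 1))
    (hj : j < 2 * (2 * e + 1)) :
    FF n q c i j ∈ (UU c e).image (fun p => FF n q c p.1 p.2) := by
  simp only [Finset.mem_image, Prod.exists, mem_UU]
  by_cases hjd : j < 2 * e + 1
  · exact ⟨i, j, by omega, rfl⟩
  · obtain ⟨k, rfl⟩ : ∃ k, j = k + (2 * e + 1) := ⟨j - (2 * e + 1), by omega⟩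
    exact ⟨i, k, by omega, (FF_per n q c _ i k h).symm⟩

lemma main_eq (n q c e : ℕ) (h : n = 2 * c * (2 * e + 1) * q) (hn : 0 < n) (hc : 0 < c)
    (he : 0 < e) :
    hFoldRSum 2 ((TT c e).image (fun p => FF n q c p.1 p.2)) =
      (UU c e).image (fun p => FF n q c p.1 p.2) := by
  ext x
  rw [mem_rsum]
  constructor
  · rintro ⟨a, ha, b, hb, hab, rfl⟩
    simp only [Finset.mem_image, Prod.exists, mem_TT] at ha hb
    obtain ⟨i, j, hij, rfl⟩ := ha
    obtain ⟨i', j', hij', rfl⟩ := hb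
    have hne : ¬ (i = i' ∧ j = j') := by rintro ⟨rfl, rfl⟩; exact hab rfl
    rw [FF_add]
    by_cases hcc : i = c ∧ i' = c
    · obtain ⟨hic, hic'⟩ := hcc
      have : i + i' = 0 + 2 * c := by omega
      rw [this, FF_carry]
      by_cases hw : j + j' + 1 < 2 * (2 * e + 1)
      · exact FF_sum_mem n q _ e _ _ h hc (by omega) (by omega) hw
      · omega
    · exact FF_sum_mem n q _ e _ _ h hc (by omega) (by omega) (by omega)
  · intro hx
    simp only [Finset.mem_image, Prod.exists, mem_UU] at hx
    obtain ⟨r, k, hrk, rfl⟩ := hx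
    -- it suffices to give index pairs
    have key : ∀ i j i' j' : ℕ, (i, j) ∈ TT c e → (i', j') ∈ TT c e → ¬ (i = i' ∧ j = j') →
        FF n q c (i + i') (j + j') = FF n q c r k →
        ∃ a ∈ (TT c e).image (fun p => FF n q c p.1 p.2),
          ∃ b ∈ (TT c e).image (fun p => FF n q c p.1 p.2), a ≠ b ∧ a + b = FF n q c r k := by
      intro i j i' j' h1 h2 h3 h4
      refine ⟨_, Finset.mem_image_of_mem _ h1, _, Finset.mem_image_of_mem _ h2, ?_, ?_⟩
      · intro hE
        rw [mem_TT] at h1 h2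
        exact h3 (FF_inj n q c (2 * e + 1) i j i' j' h hn (by omega) (by omega) (by omega)
          (by omega) hE)
      · rw [FF_add]; exact h4
    simp only [mem_TT] at key
    rcases Nat.eq_zero_or_pos r with hr | hr
    · subst hr
      by_cases hke : k ≤ e
      · exact key 0 0 0 k (by omega) (by omega) (by omega) (by simp)
      · exact key 0 e 0 (k - e) (by omega) (by omega) (by omega)
          (by rw [show e + (k - e) = k by omega])
    rcases lt_trichotomy r c with hrc | hrc | hrc
    · exact key 0 0 r k (by omega) (by omega) (by omega) (by simp)
    · subst hrc
      by_cases hke : e ≤ k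
      · exact key 0 0 r k (by omega) (by omega) (by omega) (by simp)
      · exact key 0 (k + 1) r (2 * e) (by omega) (by omega) (by omega)
          (by rw [show k + 1 + 2 * e = k + (2 * e + 1) by omega, FF_per n q r _ _ k h]; simp)
    · by_cases hke : e ≤ k
      · exact key c e (r - c) (k - e) (by omega) (by omega) (by omega)
          (by rw [show e + (k - e) = k by omega, show c + (r - c) = r by omega])
      · exact key c (2 * e) (r - c) (k + 1) (by omega) (by omega) (by omega)
          (by rw [show 2 * e + (k + 1) = k + (2 * e + 1) by omega, FF_per n q c _ _ k h,
                show c + (r - c) = r by omega])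

theorem stmt5 (n m d : ℕ) (hn : 0 < n) (hm : 0 < m)
    (hpow : ¬ ∃ k : ℕ, m - 1 = 2 ^ k) (hdvd : 2 * m - 2 ∣ n)
    (hd : d ∣ m - 1) (hodd : Odd d) (hd1 : 1 < d) :
    (Bset n d ((d + 1) / 2) ((d + 1) / 2) ((m - 1) / d) ((d - 1) / 2)
        ((n / (2 * m - 2) : ℕ) : ZMod n)).card = m ∧
    (hFoldRSum 2 (Bset n d ((d + 1) / 2) ((d + 1) / 2) ((m - 1) / d) ((d - 1) / 2)
        ((n / (2 * m - 2) : ℕ) : ZMod n))).card = 2 * m - 4 := by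
  obtain ⟨e, rfl⟩ := hodd
  obtain ⟨c, hc⟩ := hd
  obtain ⟨q, hq⟩ := hdvd
  have hm2 : 2 * m - 2 = 2 * c * (2 * e + 1) := by
    rw [show 2 * m - 2 = 2 * (m - 1) by omega, hc]; ring
  have h : n = 2 * c * (2 * e + 1) * q := by rw [hq, hm2]
  have hpos : 0 < 2 * m - 2 := by
    rcases Nat.eq_zero_or_pos (2 * m - 2) with h0 | h0
    · rw [h0] at hq; omega
    · exact h0
  have hc0 : 0 < c := by
    rcases Nat.eq_zero_or_pos c with h0 | h0
    · subst h0; simp at hc; omega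
    · exact h0
  have he : 0 < e := by omega
  have e1 : (2 * e + 1 + 1) / 2 = e + 1 := by omega
  have e2 : (2 * e + 1 - 1) / 2 = e := by omega
  have e3 : (m - 1) / (2 * e + 1) = c := by
    rw [hc]; exact Nat.mul_div_cancel_left _ (by omega)
  have e4 : n / (2 * m - 2) = q := by
    rw [hq]; exact Nat.mul_div_cancel_left _ hpos
  rw [e1, e2, e3, e4, Bset_eq n q c e h, main_eq n q c e h hn hc0 he,
    Finset.card_image_of_injOn, Finset.card_image_of_injOn, TT_card c e hc0, UU_card c e hc0 he]
  · constructor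
    · rw [mul_comm, ← hc]; omega
    · rw [← hm2]; omega
  · rintro ⟨i, j⟩ h1 ⟨i', j'⟩ h2 hE
    rw [Finset.mem_coe, mem_UU] at h1 h2
    have := FF_inj n q c (2 * e + 1) i j i' j' h hn (by omega) (by omega) (by omega) (by omega) hE
    rw [this.1, this.2]
  · rintro ⟨i, j⟩ h1 ⟨i', j'⟩ h2 hE
    rw [Finset.mem_coe, mem_TT] at h1 h2
    have := FF_inj n q c (2 * e + 1) i j i' j' h hn (by omega) (by omega) (by omega) (by omega) hE
    rw [this.1, this.2]
end

section
/- Let n be a positive integer divisible by 10. Then the set B = B_5(n, 6; 4, 2, n/10, 3), i.e. B = {j·(n/5) : j = 0,1,2,3} ∪ {n/10 + j·(n/5) : j = 3,4}, is a 6-element subset of Z_n whose 3-fold restricted sumset has size |3^B| = 9. -/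
open Finset

theorem hFoldRSum_image_aux {G K : Type*} [AddCommMonoid G] [AddCommMonoid K] [DecidableEq G]
    [DecidableEq K] (f : G →+ K) (hf : Function.Injective f) (h : ℕ) (A : Finset G) :
    hFoldRSum h (A.image f) = (hFoldRSum h A).image f := by
  have e : A.image f = A.map ⟨f, hf⟩ := by
    rw [Finset.map_eq_image]; rfl
  unfold hFoldRSum
  rw [e, Finset.powersetCard_map, Finset.map_eq_image, Finset.image_image, Finset.image_image]
  apply Finset.image_congr
  intro s _
  simp [Finset.mapEmbedding_apply, map_sum]

theorem stmt6 (n : ℕ) (hn : 0 < n) (h10 : 10 ∣ n) :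
    (Bset n 5 4 2 1 3 ((n / 10 : ℕ) : ZMod n)).card = 6 ∧
    (hFoldRSum 3 (Bset n 5 4 2 1 3 ((n / 10 : ℕ) : ZMod n))).card = 9 := by
  obtain ⟨q, rfl⟩ := h10
  have hq : 0 < q := by omega
  have hd : 10 * q / 10 = q := by omega
  have hd5 : 10 * q / 5 = 2 * q := by omega
  have h0 : zmultiplesHom (ZMod (10 * q)) (q : ZMod (10 * q)) ((10 : ℕ) : ℤ) = 0 := by
    have := ZMod.natCast_self (10 * q)
    rw [zmultiplesHom_apply]
    push_cast at this
    simpa using this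
  let f : ZMod 10 →+ ZMod (10 * q) := ZMod.lift 10 ⟨zmultiplesHom _ (q : ZMod (10 * q)), h0⟩
  have hf : Function.Injective f := by
    refine (ZMod.lift_injective 10).2 ?_
    intro m hm
    have hm' : ((m * q : ℤ) : ZMod (10 * q)) = 0 := by
      simpa [zmultiplesHom_apply] using hm
    rw [ZMod.intCast_zmod_eq_zero_iff_dvd] at *
    push_cast at hm'
    exact Int.dvd_of_mul_dvd_mul_right (by omega) hm'
  have hfn : ∀ k : ℕ, f (k : ZMod 10) = (k : ZMod (10 * q)) * q := by
    intro k
    have := ZMod.lift_coe 10 ⟨zmultiplesHom _ (q : ZMod (10 * q)), h0⟩ (k : ℤ)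
    simpa [zmultiplesHom_apply, f] using this
  have hB : Bset (10 * q) 5 4 2 1 3 ((10 * q / 10 : ℕ) : ZMod (10 * q))
      = (({0, 2, 4, 6, 7, 9} : Finset (ZMod 10))).image f := by
    have e : ({0, 2, 4, 6, 7, 9} : Finset (ZMod 10)) =
      ({0, 2, 4, 6, 7, 9} : Finset ℕ).image (fun k : ℕ => (k : ZMod 10)) := by decide
    rw [e, Finset.image_image]
    have e2 : (f ∘ fun k : ℕ => (k : ZMod 10)) = fun k : ℕ => (k : ZMod (10 * q)) * q :=
      funext hfn
    rw [e2]
    unfold Bset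
    rw [hd, hd5]
    have e3 : ({0, 2, 4, 6, 7, 9} : Finset ℕ) =
      (range 4).image (fun j => 2 * j) ∪ (range 2).image (fun j => 7 + 2 * j) := by decide
    rw [e3, Finset.image_union, Finset.image_image, Finset.image_image]
    simp only [Finset.Ico_self, Finset.empty_product, Finset.image_empty, Finset.union_empty]
    congr 1 <;> apply Finset.image_congr <;> intro j _ <;> simp <;> ring
  rw [hB, hFoldRSum_image_aux f hf, Finset.card_image_of_injective _ hf,
    Finset.card_image_of_injective _ hf]
  decide +kernel
end

section
/- For every integer h ≥ 3 and every positive real number C, there exist a positive integer n and a positive integer m ≤ n such that ρ^(Z_n, m, h) < ρ(Z_n, m, h) − C, where Z_n is the cyclic group of order n. -/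
open Finset

open scoped Pointwise

lemma key8 {G : Type*} [AddCommGroup G] [DecidableEq G] {p d : ℕ} (hp : p.Prime)
    (f : G →+ ZMod p)
    (hcd : ∀ s t : Finset G, s.Nonempty → t.Nonempty → min d (#s + #t - 1) ≤ #(s + t))
    (hfib : ∀ (s : Finset G) (y : ZMod p), (∀ x ∈ s, f x = y) → #s ≤ d)
    (hd : 2 ≤ d) (hpd : 3 * d ≤ p) (A : Finset G) (hA : #A = d + 1) :
    7 * d ≤ 3 * #(A + A + A) := by
  classical
  set B := A.image f with hB
  set F : ZMod p → Finset G := fun x => A.filter (fun a => f a = x) with hF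
  have hAne : A.Nonempty := by rw [← card_pos]; omega
  have hBne : B.Nonempty := hAne.image _
  obtain ⟨x1, hx1, hmax⟩ := exists_max_image B (fun x => #(F x)) hBne
  set a := #(F x1) with ha
  set b := #B with hb
  have hFne : ∀ x ∈ B, (F x).Nonempty := by
    intro x hx
    obtain ⟨y, hy, rfl⟩ := mem_image.1 hx
    exact ⟨y, by simp [hF, hy]⟩
  have ha1 : 1 ≤ a := (hFne x1 hx1).card_pos
  have had : a ≤ d := hfib _ x1 (by simp [hF])
  have hsum : ∑ x ∈ B, #(F x) = d + 1 := by
    rw [← hA]; exact (card_eq_sum_card_image f A).symm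
  have hsum2 : ∑ x ∈ B.erase x1, #(F x) + a = d + 1 := by
    rw [← hsum]; exact sum_erase_add _ _ hx1
  have hbe : #(B.erase x1) = b - 1 := card_erase_of_mem hx1
  have hb1 : 1 ≤ b := hBne.card_pos
  have hab : d + 1 ≤ b * a := by
    rw [← hsum]; simpa using sum_le_card_nsmul B (fun x => #(F x)) a hmax
  have hapb : b - 1 + a ≤ d + 1 := by
    have := card_nsmul_le_sum (B.erase x1) (fun x => #(F x)) 1
      (fun x hx => (hFne x (mem_of_mem_erase hx)).card_pos)
    rw [hbe] at this; simp at this; omega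
  have hb2 : 2 ≤ b := by
    by_contra hlt
    have : b = 1 := by omega
    rw [this] at hab; omega
  set S := A + A + A with hS
  set g : ZMod p → ℕ := fun y => #(S.filter (fun s => f s = y)) with hg
  have hSim : S.image f = B + B + B := by
    rw [hS, image_add, image_add]
  have hScard : #S = ∑ y ∈ B + B + B, g y := by
    rw [← hSim]; exact card_eq_sum_card_image f S
  have hsub : ∀ x y z, F x + F y + F z ⊆ S.filter (fun s => f s = x + y + z) := by
    intro x y z s hs
    obtain ⟨u', hu', w, hw, rfl⟩ := mem_add.1 hs
    obtain ⟨u, hu, v, hv, rfl⟩ := mem_add.1 hu'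
    replace hu := mem_filter.1 hu
    replace hv := mem_filter.1 hv
    replace hw := mem_filter.1 hw
    refine mem_filter.2 ⟨add_mem_add (add_mem_add hu.1 hv.1) hw.1, ?_⟩
    simp [hu.2, hv.2, hw.2]
  have hg3 : ∀ y ∈ B + B + B, 1 ≤ g y := by
    intro y hy
    rw [← hSim] at hy
    obtain ⟨s, hs, rfl⟩ := mem_image.1 hy
    exact card_pos.2 ⟨s, mem_filter.2 ⟨hs, rfl⟩⟩
  have hg2 : ∀ y ∈ ({x1} : Finset (ZMod p)) + B + B, a ≤ g y := by
    intro y hy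
    rw [add_assoc] at hy
    obtain ⟨x', hx', w, hw, rfl⟩ := mem_add.1 hy
    have hx'' := mem_singleton.1 hx'
    rw [hx'']
    obtain ⟨u, hu, v, hv, rfl⟩ := mem_add.1 hw
    have h1 := card_le_card (hsub x1 u v)
    rw [add_assoc] at h1
    have h2 : #(F x1) ≤ #(F x1 + (F u + F v)) :=
      card_le_card_add_right ((hFne u hu).add (hFne v hv))
    simp only [hg]
    rw [add_assoc] at h1
    exact h2.trans h1
  have hg1 : ∀ x ∈ B, min d (2 * a - 2 + #(F x)) ≤ g (x1 + x1 + x) := by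
    intro x hx
    have h1 := card_le_card (hsub x1 x1 x)
    have h2 := hcd (F x1) (F x1) (hFne x1 hx1) (hFne x1 hx1)
    have h3 := hcd (F x1 + F x1) (F x) ((hFne x1 hx1).add (hFne x1 hx1)) (hFne x hx)
    have h4 := (hFne x hx).card_pos
    simp only [hg]
    omega
  have hs12 : ({x1} : Finset (ZMod p)) + {x1} + B ⊆ {x1} + B + B :=
    add_subset_add_right (add_subset_add_left (by simpa using hx1))
  have hs23 : ({x1} : Finset (ZMod p)) + B + B ⊆ B + B + B :=
    add_subset_add_right (add_subset_add_right (by simpa using hx1))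
  set t := #(B + B) with ht
  have hc1 : #(({x1} : Finset (ZMod p)) + {x1} + B) = b := by
    rw [singleton_add_singleton, card_singleton_add]
  have hc2 : #(({x1} : Finset (ZMod p)) + B + B) = t := by
    rw [add_assoc, card_singleton_add]
  have hcdB := ZMod.cauchy_davenport hp hBne hBne
  have hcdB2 := ZMod.cauchy_davenport hp (hBne.add hBne) hBne
  have hS3 : #(B + B + B) ≤ #S := by rw [← hSim]; exact card_image_le
  have hsum1 : ∑ y ∈ ({x1} : Finset (ZMod p)) + {x1} + B, g y = ∑ x ∈ B, g (x1 + x1 + x) := by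
    have him : ({x1} : Finset (ZMod p)) + {x1} + B = B.image (fun x => x1 + x1 + x) := by
      ext z
      rw [singleton_add_singleton, mem_add, mem_image]
      simp only [mem_singleton, exists_eq_left]
    rw [him]
    exact sum_image (fun u _ v _ h => add_left_cancel h)
  have hlow : ∑ x ∈ B, g (x1 + x1 + x) + (t - b) * a + (#(B + B + B) - t) ≤ #S := by
    rw [hScard, ← sum_sdiff hs23, ← sum_sdiff hs12, hsum1]
    have e1 := card_nsmul_le_sum ((B + B + B) \ (({x1} : Finset (ZMod p)) + B + B)) (fun y => g y) 1
      (fun y hy => hg3 y (mem_sdiff.1 hy).1)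
    have e2 := card_nsmul_le_sum
      ((({x1} : Finset (ZMod p)) + B + B) \ (({x1} : Finset (ZMod p)) + {x1} + B)) (fun y => g y) a
      (fun y hy => hg2 y (mem_sdiff.1 hy).1)
    rw [card_sdiff_of_subset hs23, hc2] at e1
    rw [card_sdiff_of_subset hs12, hc2, hc1] at e2
    simp only [smul_eq_mul] at e1 e2
    omega
  rcases le_or_gt p #S with hpS | hpS
  · omega
  have ht2 : t - b ≥ b - 1 := by omega
  have ht3 : #(B + B + B) - t ≥ b - 1 := by omega
  have hlow2 : ∑ x ∈ B, g (x1 + x1 + x) + (b - 1) * a + (b - 1) ≤ #S := by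
    have := Nat.mul_le_mul_right a ht2
    omega
  obtain ⟨c, hc⟩ : ∃ c, b = c + 1 := ⟨b - 1, by omega⟩
  simp only [hc, Nat.add_sub_cancel] at hlow2 hbe hapb
  rw [hc] at hab
  rcases Nat.lt_or_ge d (3 * a - 2) with h3 | h3
  · have hx1g : d ≤ g (x1 + x1 + x1) := by
      have := hg1 x1 hx1
      omega
    rw [← sum_erase_add _ _ hx1] at hlow2
    rcases Nat.lt_or_ge c 2 with hc2' | hc2'
    · have hc1' : c = 1 := by omega
      subst hc1'
      obtain ⟨x2, hx2⟩ := card_eq_one.1 hbe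
      rw [hx2] at hlow2 hsum2
      simp only [sum_singleton] at hlow2 hsum2
      have := hg1 x2 (mem_of_mem_erase (by rw [hx2]; simp))
      omega
    · have e := card_nsmul_le_sum (B.erase x1) (fun x => g (x1 + x1 + x)) (min d (2 * a - 1))
        (fun x hx => by
          have := hg1 x (mem_of_mem_erase hx)
          have := (hFne x (mem_of_mem_erase hx)).card_pos
          omega)
      rw [hbe] at e
      simp only [smul_eq_mul] at e
      have e3 := Nat.mul_le_mul_right (min d (2 * a - 1)) hc2'
      have e4 := Nat.mul_le_mul_right a hc2'
      omega
  · have e : ∑ x ∈ B, (2 * a - 2 + #(F x)) ≤ ∑ x ∈ B, g (x1 + x1 + x) := by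
      refine sum_le_sum fun x hx => ?_
      have := hg1 x hx
      have := hmax x hx
      omega
    rw [sum_add_distrib, hsum, sum_const, ← hb, hc, smul_eq_mul] at e
    obtain ⟨a', ha'⟩ : ∃ a', a = a' + 1 := ⟨a - 1, by omega⟩
    rw [ha'] at e hlow2 hab hapb
    have : 2 * (a' + 1) - 2 = 2 * a' := by omega
    rw [this] at e
    nlinarith

lemma three8 {G : Type*} [AddCommGroup G] [DecidableEq G] (h : ℕ) (hh : 3 ≤ h) (A : Finset G)
    (hA : A.Nonempty) : #(A + A + A) ≤ #(hFoldSum h A) := by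
  obtain ⟨k, rfl⟩ := Nat.exists_eq_add_of_le' hh
  obtain ⟨a, ha⟩ := hA
  rw [← card_add_singleton (A + A + A) (k • a)]
  refine card_le_card fun s hs => ?_
  obtain ⟨s', hs', z, hz, rfl⟩ := mem_add.1 hs
  obtain rfl := mem_singleton.1 hz
  obtain ⟨u', hu', w, hw, rfl⟩ := mem_add.1 hs'
  obtain ⟨u, hu, v, hv, rfl⟩ := mem_add.1 hu'
  refine mem_image.2 ⟨Fin.cons u (Fin.cons v (Fin.cons w (fun _ => a))), ?_, ?_⟩
  · rw [Fintype.mem_piFinset]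
    intro i
    refine Fin.cases ?_ (fun i => ?_) i
    · exact hu
    refine Fin.cases ?_ (fun i => ?_) i
    · exact hv
    refine Fin.cases ?_ (fun i => ?_) i
    · exact hw
    · exact ha
  · simp [Fin.sum_univ_succ, add_assoc]

theorem stmt8 (h : ℕ) (hh : 3 ≤ h) (C : ℝ) (hC : 0 < C) :
    ∃ n m : ℕ, 0 < n ∧ 0 < m ∧ m ≤ n ∧
      (rhoHat (ZMod n) m h : ℝ) < (rho (ZMod n) m h : ℝ) - C := by
  obtain ⟨d, hdge, hdp⟩ := Nat.exists_infinite_primes (⌈3 * C⌉₊ + 2)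
  obtain ⟨p, hpge, hpp⟩ := Nat.exists_infinite_primes (3 * d + 1)
  have hd2 := hdp.two_le
  have hp2 := hpp.two_le
  have hn0 : 0 < d * p := Nat.mul_pos (by omega) (by omega)
  have : NeZero (d * p) := ⟨hn0.ne'⟩
  have : NeZero p := ⟨by omega⟩
  have hdn : d ≤ d * p := Nat.le_mul_of_pos_right d (by omega)
  have hdn2 : d * 2 ≤ d * p := Nat.mul_le_mul_left d hp2
  refine ⟨d * p, d + 1, hn0, by omega, by omega, ?_⟩
  set f : ZMod (d * p) →+ ZMod p := (ZMod.castHom (Dvd.intro_left d rfl) (ZMod p)).toAddMonoidHom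
    with hf
  have hfnat : ∀ k : ℕ, f (k : ZMod (d * p)) = (k : ZMod p) := fun k => by
    simp [hf]
  have hfib : ∀ (s : Finset (ZMod (d * p))) (y : ZMod p), (∀ x ∈ s, f x = y) → #s ≤ d := by
    intro s y hs
    refine (card_le_card_of_injOn (t := range d) (fun x => x.val / p) ?_ ?_).trans
      (card_range d).le
    · intro x hx
      simp only [coe_range, Set.mem_Iio]
      exact (Nat.div_lt_iff_lt_mul (by omega)).2 (ZMod.val_lt x)
    · intro u hu v hv huv
      have h1 : f u = f v := (hs u hu).trans (hs v hv).symm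
      rw [← ZMod.natCast_zmod_val u, ← ZMod.natCast_zmod_val v, hfnat, hfnat,
        ZMod.natCast_eq_natCast_iff'] at h1
      simp only at huv
      apply ZMod.val_injective
      rw [← Nat.div_add_mod u.val p, ← Nat.div_add_mod v.val p, h1, huv]
  have hcd : ∀ s t : Finset (ZMod (d * p)), s.Nonempty → t.Nonempty →
      min d (#s + #t - 1) ≤ #(s + t) := by
    intro s t hs ht
    have h1 := cauchy_davenport_minOrder_add hs ht
    have h2 : (d * p).minFac = d := by
      have hne : d * p ≠ 1 := by omega
      have hle := Nat.minFac_le_of_dvd hd2 (Dvd.intro p rfl)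
      have hmp := Nat.minFac_prime hne
      rcases (hmp.dvd_mul).1 (Nat.minFac_dvd (d * p)) with h | h
      · exact (Nat.prime_dvd_prime_iff_eq hmp hdp).1 h
      · have := (Nat.prime_dvd_prime_iff_eq hmp hpp).1 h
        omega
    rw [ZMod.minOrder hn0.ne' (by omega), h2] at h1
    simpa only [min_le_iff, Nat.cast_le] using h1
  -- lower bound
  have hlow : 7 * d ≤ 3 * rho (ZMod (d * p)) (d + 1) h := by
    obtain ⟨A, hA, hk⟩ : rho (ZMod (d * p)) (d + 1) h ∈
        { k | ∃ A : Finset (ZMod (d * p)), A.card = d + 1 ∧ (hFoldSum h A).card = k } := by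
      apply Nat.sInf_mem
      obtain ⟨A, -, hA⟩ := exists_subset_card_eq (s := (univ : Finset (ZMod (d * p))))
        (n := d + 1) (by rw [card_univ, ZMod.card]; omega)
      exact ⟨_, A, hA, rfl⟩
    rw [← hk]
    have h1 := key8 hpp f hcd hfib hd2 (by omega) A hA
    have h2 := three8 h hh A (by rw [← card_pos]; omega)
    omega
  have hup : rhoHat (ZMod (d * p)) (d + 1) h ≤ 2 * d := by
    set D : Finset (ZMod (d * p)) := (range d).image (fun j : ℕ => ((1 + j * p : ℕ) : ZMod (d * p)))
      with hD
    have hlt : ∀ j < d, 1 + j * p < d * p := by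
      intro j hj
      have : (j + 1) * p ≤ d * p := Nat.mul_le_mul_right p hj
      rw [Nat.succ_mul] at this
      omega
    have hDc : #D = d := by
      rw [hD, card_image_of_injOn, card_range]
      intro i hi j hj hij
      have hi' : i < d := by simpa using hi
      have hj' : j < d := by simpa using hj
      have := congrArg ZMod.val hij
      simp only at this
      rw [ZMod.val_natCast_of_lt (hlt i hi'), ZMod.val_natCast_of_lt (hlt j hj')] at this
      exact Nat.eq_of_mul_eq_mul_right (by omega : 0 < p) (by omega)
    have hDf : ∀ x ∈ D, f x = 1 := by
      intro x hx
      obtain ⟨j, _, rfl⟩ := mem_image.1 hx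
      rw [hfnat]; simp
    have : Fact (1 < p) := ⟨by omega⟩
    have h0 : (0 : ZMod (d * p)) ∉ D := by
      intro h
      have := hDf 0 h
      simp at this
    have hle : #(hFoldRSum h (insert 0 D)) ≤ 2 * d := by
      have hcov : hFoldRSum h (insert 0 D) ⊆
          univ.filter (fun x => f x = ((h - 1 : ℕ) : ZMod p)) ∪
          univ.filter (fun x => f x = (h : ZMod p)) := by
        intro x hx
        obtain ⟨s, hs, rfl⟩ := mem_image.1 hx
        rw [mem_powersetCard] at hs
        have key : ∀ r : Finset (ZMod (d * p)), r ⊆ D → f (∑ x ∈ r, x) = (#r : ZMod p) := by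
          intro r hr
          rw [map_sum, sum_congr rfl (fun x hx => hDf x (hr hx))]
          simp
        simp only [mem_union, mem_filter, mem_univ, true_and]
        by_cases hz : (0 : ZMod (d * p)) ∈ s
        · left
          rw [← sum_erase_add _ _ hz, add_zero, key, card_erase_of_mem hz, hs.2]
          exact subset_insert_iff.1 hs.1
        · right
          rw [key, hs.2]
          exact (subset_insert_iff_of_notMem hz).1 hs.1
      have h1 := card_le_card hcov
      have h2 := card_union_le (univ.filter (fun x => f x = ((h - 1 : ℕ) : ZMod p)))
          (univ.filter (fun x => f x = (h : ZMod p)))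
      have h3 := hfib (univ.filter (fun x => f x = ((h - 1 : ℕ) : ZMod p))) _
        (fun x hx => (mem_filter.1 hx).2)
      have h4 := hfib (univ.filter (fun x => f x = (h : ZMod p))) _
        (fun x hx => (mem_filter.1 hx).2)
      omega
    have hc : #(insert 0 D) = d + 1 := by rw [card_insert_of_notMem h0, hDc]
    have hmem : #(hFoldRSum h (insert 0 D)) ∈
        { k | ∃ A : Finset (ZMod (d * p)), A.card = d + 1 ∧ (hFoldRSum h A).card = k } :=
      ⟨insert 0 D, hc, rfl⟩
    exact (Nat.sInf_le hmem).trans hle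
  have hC1 : 3 * C ≤ (⌈3 * C⌉₊ : ℝ) := Nat.le_ceil _
  have hC2 : ((⌈3 * C⌉₊ + 2 : ℕ) : ℝ) ≤ (d : ℝ) := by exact_mod_cast hdge
  have hl : 7 * (d : ℝ) ≤ 3 * (rho (ZMod (d * p)) (d + 1) h : ℝ) := by exact_mod_cast hlow
  have hu : (rhoHat (ZMod (d * p)) (d + 1) h : ℝ) ≤ 2 * d := by exact_mod_cast hup
  push_cast at hC2
  linarith
end

section
/- Let h be a positive integer, p a prime with p > h, and t an integer with t ≥ 2. Set n = p^t and m = p^{t−1} + 1. Then ρ(Z_n, m, h) = h·p^{t−1} + 1. -/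
open Finset

open scoped Pointwise

lemma hFoldSum_succ {G : Type*} [AddCommMonoid G] [DecidableEq G] (h : ℕ) (A : Finset G) :
    hFoldSum (h + 1) A = hFoldSum h A + A := by
  ext x
  simp only [hFoldSum, Finset.mem_image, Fintype.mem_piFinset, Finset.mem_add]
  constructor
  · rintro ⟨f, hf, rfl⟩
    refine ⟨_, ⟨fun i => f i.succ, fun i => hf _, rfl⟩, f 0, hf 0, ?_⟩
    rw [Fin.sum_univ_succ, add_comm]
  · rintro ⟨_, ⟨f, hf, rfl⟩, a, ha, rfl⟩
    refine ⟨Fin.cons a f, fun i => ?_, ?_⟩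
    · refine Fin.cases ?_ (fun j => ?_) i
      · simpa using ha
      · simpa using hf j
    · rw [Fin.sum_univ_succ, add_comm]; simp

lemma hFoldSum_zero {G : Type*} [AddCommMonoid G] [DecidableEq G] (A : Finset G) :
    hFoldSum 0 A = {0} := by
  ext x
  simp [hFoldSum, eq_comm]

/-- Mann's theorem. -/
lemma mann {G : Type*} [AddCommGroup G] [Fintype G] [DecidableEq G] (S Y : Finset G)
    (hS : S.Nonempty) (hY : Y.Nonempty) (hYS : Y + S ≠ univ) :
    ∃ H : AddSubgroup G, H ≠ ⊤ ∧ ∃ X : Finset G, (X : Set G) = H ∧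
      (X + S).card + Y.card ≤ (Y + S).card + X.card := by
  classical
  let F : Finset (Finset G) := univ.filter fun X => X.Nonempty ∧ X + S ≠ univ
  have hF : ∀ X, X ∈ F ↔ X.Nonempty ∧ X + S ≠ univ := fun X => by simp [F]
  obtain ⟨Z, hZ, hZm⟩ := F.exists_min_image (fun X => ((X + S).card : ℤ) - X.card)
    ⟨Y, (hF _).2 ⟨hY, hYS⟩⟩
  obtain ⟨κ, hκ⟩ : ∃ κ : ℤ, κ = (Z + S).card - Z.card := ⟨_, rfl⟩
  have hmin : ∀ X : Finset G, X.Nonempty → X + S ≠ univ → κ ≤ (X + S).card - X.card :=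
    fun X h1 h2 => hκ ▸ hZm X ((hF _).2 ⟨h1, h2⟩)
  let F2 : Finset (Finset G) := F.filter fun X => ((X + S).card : ℤ) - X.card = κ
  obtain ⟨X, hX, hXm⟩ := F2.exists_min_image (fun X => X.card) ⟨Z, by simp [F2, hZ, hκ]⟩
  have hF2 : ∀ X, X ∈ F2 ↔ (X.Nonempty ∧ X + S ≠ univ) ∧ ((X + S).card : ℤ) - X.card = κ :=
    fun X => by simp [F2, hF]
  have hmin2 : ∀ W : Finset G, W.Nonempty → W + S ≠ univ →
      ((W + S).card : ℤ) - W.card ≤ κ → X.card ≤ W.card := fun W h1 h2 h3 =>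
    hXm W ((hF2 _).2 ⟨⟨h1, h2⟩, le_antisymm h3 (hmin W h1 h2)⟩)
  obtain ⟨⟨hXne, hXS⟩, hXκ⟩ := (hF2 X).1 hX
  -- translate
  have htr : ∀ g : G, ((g +ᵥ X) + S).card = (X + S).card ∧ (g +ᵥ X).card = X.card := by
    intro g
    rw [vadd_add_assoc, Finset.card_vadd_finset, Finset.card_vadd_finset]; simp
  have hn : ∀ W : Finset G, W ≠ univ ↔ W.card < Fintype.card G := fun W => by
    rw [← Finset.card_lt_iff_ne_univ]
  -- dual bound
  have hdual : 2 * (X.card : ℤ) + κ ≤ Fintype.card G := by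
    have hsub : (-(X + S)ᶜ) + S ⊆ (-X)ᶜ := by
      intro z hz
      simp only [Finset.mem_add, Finset.mem_neg', Finset.mem_compl] at hz ⊢
      obtain ⟨a, ha, s, hs, rfl⟩ := hz
      intro h
      exact ha ⟨_, h, s, hs, by abel⟩
    have hne : (-(X + S)ᶜ).Nonempty := by
      rw [Finset.neg_nonempty_iff, Finset.nonempty_iff_ne_empty]
      simpa using hXS
    have hc1 := Finset.card_le_card hsub
    have h1 : (-X)ᶜ.card + X.card = Fintype.card G := by
      have := Finset.card_compl_add_card (-X); simpa using this
    have h2 : (-(X + S)ᶜ).card + (X + S).card = Fintype.card G := by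
      have := Finset.card_compl_add_card (X + S); simpa using this
    have hp := hXne.card_pos
    have := hmin2 _ hne ((hn _).2 (by omega)) (by omega)
    omega
  -- atoms
  have hatom : ∀ g : G, ((g +ᵥ X) ∩ X).Nonempty → g +ᵥ X = X := by
    intro g hg
    obtain ⟨ht1, ht2⟩ := htr g
    set W := g +ᵥ X with hW
    have hi : (W ∩ X) + S ⊆ (W + S) ∩ (X + S) := Finset.inter_add_subset
    have hu : (W ∪ X) + S = (W + S) ∪ (X + S) := Finset.union_add
    have c1 := Finset.card_le_card hi
    have c2 := Finset.card_union_add_card_inter (W + S) (X + S)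
    have c3 := Finset.card_union_add_card_inter W X
    have c4 : ((W ∩ X) + S).card ≤ (X + S).card :=
      Finset.card_le_card (Finset.add_subset_add_right Finset.inter_subset_right)
    have hXS' := (hn _).1 hXS
    have hiu : (W ∩ X) + S ≠ univ := (hn _).2 (by omega)
    have c5 := hmin _ hg hiu
    have c6 := hg.card_pos
    rw [← hu] at c2
    have huu : (W ∪ X) + S ≠ univ := (hn _).2 (by omega)
    have c7 := hmin _ (hXne.mono Finset.subset_union_right) huu
    have c8 := hmin2 _ hg hiu (by omega)
    have e1 : W ∩ X = X := Finset.eq_of_subset_of_card_le Finset.inter_subset_right c8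
    have e2 : W ∩ X = W := Finset.eq_of_subset_of_card_le Finset.inter_subset_left (by omega)
    rw [← e2, e1]
  obtain ⟨x₀, hx₀⟩ := hXne
  -- subgroup
  have hmem : ∀ g : G, x₀ + g ∈ X → g +ᵥ X = X := fun g hg => hatom g
    ⟨x₀ + g, Finset.mem_inter.2 ⟨Finset.mem_vadd_finset.2 ⟨x₀, hx₀, by simp [add_comm]⟩, hg⟩⟩
  have hmem' : ∀ g : G, g +ᵥ X = X → x₀ + g ∈ X := fun g hg => by
    rw [← hg]; exact Finset.mem_vadd_finset.2 ⟨x₀, hx₀, by simp [add_comm]⟩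
  let H : AddSubgroup G := AddAction.stabilizer G X
  have hHX : (((-x₀) +ᵥ X : Finset G) : Set G) = H := by
    ext g
    simp only [Finset.mem_coe, SetLike.mem_coe, H, AddAction.mem_stabilizer_iff]
    rw [Finset.mem_vadd_finset]
    constructor
    · rintro ⟨y, hy, rfl⟩
      exact hmem _ (by simpa using hy)
    · intro h
      exact ⟨_, hmem' g h, by simp⟩
  obtain ⟨ht1, ht2⟩ := htr (-x₀)
  refine ⟨H, ?_, _, hHX, ?_⟩
  · intro htop
    rw [htop] at hHX
    have : (-x₀ +ᵥ X).card = Fintype.card G := by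
      rw [Finset.card_eq_iff_eq_univ]; rw [← Finset.coe_eq_univ, hHX]; rfl
    have h2 := Finset.card_le_card_add_right (s := X) hS
    have := (hn _).1 hXS
    omega
  · have := hmin Y hY hYS
    omega

lemma step (p t : ℕ) (hp : p.Prime) (ht : 2 ≤ t) [NeZero (p ^ t)] (S Y : Finset (ZMod (p ^ t)))
    (hS : S.card = p ^ (t - 1) + 1) (hY : Y.Nonempty) (hYS : Y + S ≠ univ) :
    Y.card + p ^ (t - 1) ≤ (Y + S).card := by
  have hSne : S.Nonempty := Finset.card_pos.1 (by omega)
  obtain ⟨H, hH, X, hX, hle⟩ := mann S Y hSne hY hYS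
  have hXc : Nat.card H = X.card := by
    have h1 : Nat.card (X : Set (ZMod (p ^ t))) = Nat.card (H : Set (ZMod (p ^ t))) := by rw [hX]
    simpa using h1.symm
  have hdiv : X.card ∣ (X + S).card := by
    have h1 := AddSubgroup.card_add_eq_card_addSubgroup_add_card_quotient H
      (S : Set (ZMod (p ^ t)))
    rw [hXc, ← hX, ← Finset.coe_add, add_comm S X] at h1
    have h2 : Nat.card ((X + S : Finset (ZMod (p ^ t))) : Set (ZMod (p ^ t))) = (X + S).card := by
      rw [Nat.card_coe_set_eq, Set.ncard_coe_finset]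
    rw [h2] at h1
    exact ⟨_, h1⟩
  have hX1 : X.card ∣ p ^ t := by
    have := H.card_addSubgroup_dvd_card
    rwa [hXc, Nat.card_zmod] at this
  obtain ⟨s, hs, hs'⟩ := (Nat.dvd_prime_pow hp).1 hX1
  have hst : s ≠ t := by
    rintro rfl
    exact hH (AddSubgroup.eq_top_of_card_eq _ (by rw [hXc, hs', Nat.card_zmod]))
  have hXq : X.card ∣ p ^ (t - 1) := hs' ▸ pow_dvd_pow p (by omega)
  have hXne : X.Nonempty := by
    rw [← Finset.coe_nonempty, hX]; exact ⟨0, H.zero_mem⟩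
  have h2 := Finset.card_le_card_add_left (t := S) hXne
  have h3 : X.card ≤ (X + S).card - p ^ (t - 1) :=
    Nat.le_of_dvd (by omega) (Nat.dvd_sub hdiv hXq)
  omega

theorem stmt9 (p t h : ℕ) (hp : p.Prime) (hh : 0 < h) (hph : h < p) (ht : 2 ≤ t) :
    rho (ZMod (p ^ t)) (p ^ (t - 1) + 1) h = h * p ^ (t - 1) + 1 := by
  have : NeZero (p ^ t) := ⟨pow_ne_zero _ hp.ne_zero⟩
  have hq : 0 < p ^ (t - 1) := pow_pos hp.pos _
  have hpq : p ^ t = p * p ^ (t - 1) := by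
    rw [← pow_succ']; congr 1; omega
  have lower : ∀ A : Finset (ZMod (p ^ t)), A.card = p ^ (t - 1) + 1 → ∀ k, k < p →
      k * p ^ (t - 1) + 1 ≤ (hFoldSum k A).card := by
    intro A hA k
    induction k with
    | zero => intro _; simp [hFoldSum_zero]
    | succ k ih =>
      intro hk
      have ih := ih (by omega)
      rw [hFoldSum_succ]
      by_cases hu : hFoldSum k A + A = univ
      · rw [hu, Finset.card_univ, ZMod.card, hpq]
        have : (k + 2) * p ^ (t - 1) ≤ p * p ^ (t - 1) := Nat.mul_le_mul_right _ (by omega)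
        linarith
      · have := step p t hp ht A _ hA (Finset.card_pos.1 (by omega)) hu
        linarith
  have hcast : ∀ k, k ≤ p ^ t → ((range k).image (Nat.cast : ℕ → ZMod (p ^ t))).card = k := by
    intro k hk
    rw [Finset.card_image_of_injOn, Finset.card_range]
    intro a ha b hb hab
    simp only [Finset.coe_range, Set.mem_Iio] at ha hb
    have := (ZMod.natCast_eq_natCast_iff' _ _ _).1 hab
    rwa [Nat.mod_eq_of_lt (by omega), Nat.mod_eq_of_lt (by omega)] at this
  let A : Finset (ZMod (p ^ t)) := (range (p ^ (t - 1) + 1)).image Nat.cast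
  have hA : A.card = p ^ (t - 1) + 1 := hcast _ (by
    have := Nat.mul_le_mul_right (p ^ (t - 1)) hp.two_le
    omega)
  have upper : ∀ k, hFoldSum k A ⊆ (range (k * p ^ (t - 1) + 1)).image Nat.cast := by
    intro k
    induction k with
    | zero => simp [hFoldSum_zero]
    | succ k ih =>
      rw [hFoldSum_succ]
      intro z hz
      obtain ⟨a, ha, b, hb, rfl⟩ := Finset.mem_add.1 hz
      obtain ⟨i, hi, rfl⟩ := Finset.mem_image.1 (ih ha)
      obtain ⟨j, hj, rfl⟩ := Finset.mem_image.1 hb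
      rw [Finset.mem_range] at hi hj
      refine Finset.mem_image.2 ⟨i + j, Finset.mem_range.2 ?_, by push_cast; rfl⟩
      rw [Nat.succ_mul]; omega
  have hAc : (hFoldSum h A).card = h * p ^ (t - 1) + 1 := by
    refine le_antisymm ?_ (lower A hA h hph)
    refine (Finset.card_le_card (upper h)).trans (Finset.card_image_le.trans ?_)
    simp
  refine le_antisymm (Nat.sInf_le ⟨A, hA, hAc⟩) ?_
  refine le_csInf ⟨_, A, hA, hAc⟩ ?_
  rintro k ⟨B, hB, rfl⟩
  exact lower B hB h hph
end

section
/- Let h ≥ 3 be an integer, p a prime with p > h, and t an integer with t ≥ 2. Set n = p^t and m = p^{t−1} + 1. Then ρ^(Z_n, m, h) ≤ 2·p^{t−1}. -/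
open Finset

theorem stmt10 (p t h : ℕ) (hp : p.Prime) (hh : 3 ≤ h) (hph : h < p) (ht : 2 ≤ t) :
    rhoHat (ZMod (p ^ t)) (p ^ (t - 1) + 1) h ≤ 2 * p ^ (t - 1) := by
  classical
  have hn : p ^ t = p ^ (t - 1) * p := by
    rw [← pow_succ]; congr 1; omega
  have : NeZero (p ^ t) := ⟨pow_ne_zero _ hp.ne_zero⟩
  let H : AddSubgroup (ZMod (p ^ t)) := AddSubgroup.zmultiples (p : ZMod (p ^ t))
  let F : Finset (ZMod (p ^ t)) := Finset.univ.filter (· ∈ H)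
  have hmem : ∀ x, x ∈ F ↔ x ∈ H := fun x => by simp [F]
  have hF : F.card = p ^ (t - 1) := by
    have h1 : Nat.card H = p ^ (t - 1) := by
      rw [Nat.card_zmultiples, ZMod.addOrderOf_coe _ (NeZero.ne _),
        Nat.gcd_eq_right (dvd_pow_self p (by omega)), hn, Nat.mul_div_cancel _ hp.pos]
    rw [← h1, Nat.card_eq_fintype_card, Fintype.card_subtype]
  have h1 : (1 : ZMod (p ^ t)) ∉ F := by
    rw [hmem]
    intro h1
    obtain ⟨k, hk⟩ := AddSubgroup.mem_zmultiples_iff.mp h1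
    have key := congrArg (ZMod.castHom (dvd_pow_self p (by omega : t ≠ 0)) (ZMod p)) hk
    have : Fact p.Prime := ⟨hp⟩
    simp [-ZMod.castHom_apply] at key
  have hsub : hFoldRSum h (insert 1 F) ⊆ F ∪ F.image (fun x => 1 + x) := by
    intro x hx
    obtain ⟨s, hs, rfl⟩ := Finset.mem_image.mp hx
    have hs := (Finset.mem_powersetCard.mp hs).1
    rw [Finset.mem_union]
    by_cases h1s : (1 : ZMod (p ^ t)) ∈ s
    · right
      refine Finset.mem_image.mpr ⟨∑ x ∈ s.erase 1, x, ?_, Finset.add_sum_erase s (fun x => x) h1s⟩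
      rw [hmem]
      refine sum_mem fun y hy => ?_
      rw [Finset.mem_erase] at hy
      exact (hmem y).1 ((Finset.mem_insert.mp (hs hy.2)).resolve_left hy.1)
    · left
      rw [hmem]
      refine sum_mem fun y hy => ?_
      exact (hmem y).1 ((Finset.mem_insert.mp (hs hy)).resolve_left fun e => h1s (e ▸ hy))
  have hcard : (hFoldRSum h (insert 1 F)).card ≤ 2 * p ^ (t - 1) := by
    have a := Finset.card_le_card hsub
    have b := Finset.card_union_le F (F.image (fun x => 1 + x))
    have c := Finset.card_image_le (s := F) (f := fun x => 1 + x)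
    omega
  refine le_trans (Nat.sInf_le ⟨insert 1 F, ?_, rfl⟩) ?_
  · rw [Finset.card_insert_of_notMem h1, hF]
  · convert hcard
end

section
/- Let k ≥ 1 be an integer and d ≥ 3 an odd integer, and let G = Z_2^k ⊕ Z_d (a group of order n = 2^k·d). Consider the subset A = Z_2^k ⊕ {0,1} of G, which has m = 2^{k+1} elements. Then A generates G, the 2-fold restricted sumset satisfies 2^A = (Z_2^k ⊕ {0,1,2}) \ ({0} ⊕ {0,2}) where 0 denotes the identity of Z_2^k, and hence |2^A| = 3·2^k − 2 < min{n − 1, 3m/2}. -/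
open Finset

theorem stmt12 (k d : ℕ) (hk : 1 ≤ k) (hd : 3 ≤ d) (hodd : Odd d) :
    ∀ A : Finset ((Fin k → ZMod 2) × ZMod d),
      A = Finset.univ ×ˢ ({0, 1} : Finset (ZMod d)) →
      A.card = 2 ^ (k + 1) ∧
      AddSubgroup.closure (A : Set ((Fin k → ZMod 2) × ZMod d)) = ⊤ ∧
      hFoldRSum 2 A =
        (Finset.univ ×ˢ ({0, 1, 2} : Finset (ZMod d))) \
          (({fun _ => (0 : ZMod 2)} : Finset (Fin k → ZMod 2)) ×ˢ ({0, 2} : Finset (ZMod d))) ∧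
      (hFoldRSum 2 A).card = 3 * 2 ^ k - 2 ∧
      ((hFoldRSum 2 A).card : ℚ) < min ((2 ^ k * d : ℚ) - 1) (3 * 2 ^ (k + 1) / 2) := by
  haveI : NeZero d := ⟨by omega⟩
  haveI : Fact (1 < d) := ⟨by omega⟩
  have h01 : (0 : ZMod d) ≠ 1 := zero_ne_one
  have h02 : (0 : ZMod d) ≠ 2 := by
    intro h
    have h2 : ((2 : ℕ) : ZMod d) = 0 := by exact_mod_cast h.symm
    rw [ZMod.natCast_eq_zero_iff] at h2
    have := Nat.le_of_dvd (by norm_num) h2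
    omega
  have h12 : (1 : ZMod d) ≠ 2 := by
    intro h
    apply h01
    have h3 : (2 : ZMod d) = 1 + 1 := by norm_num
    rw [h3] at h
    simp at h
  have hneg : ∀ x y : Fin k → ZMod 2, x + y = 0 → x = y := by
    intro x y h
    funext i
    have := congrFun h i
    simp only [Pi.add_apply, Pi.zero_apply] at this
    generalize x i = a at *
    generalize y i = b at *
    revert a b
    decide
  intro A hA
  have hmem : ∀ x c, (x, c) ∈ A ↔ c = 0 ∨ c = 1 := by
    intro x c
    simp [hA]
  have hS : hFoldRSum 2 A =
        (Finset.univ ×ˢ ({0, 1, 2} : Finset (ZMod d))) \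
          (({fun _ => (0 : ZMod 2)} : Finset (Fin k → ZMod 2)) ×ˢ ({0, 2} : Finset (ZMod d))) := by
    have hz : (fun _ => (0 : ZMod 2) : Fin k → ZMod 2) = 0 := rfl
    have key : ∀ p, p ∈ hFoldRSum 2 A ↔ ∃ a ∈ A, ∃ b ∈ A, a ≠ b ∧ a + b = p := by
      intro p
      simp only [hFoldRSum, Finset.mem_image, Finset.mem_powersetCard]
      constructor
      · rintro ⟨s, ⟨hs, hc⟩, rfl⟩
        obtain ⟨a, b, hab, rfl⟩ := Finset.card_eq_two.1 hc
        exact ⟨a, hs (by simp), b, hs (by simp), hab, (Finset.sum_pair (f := fun x => x) hab).symm⟩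
      · rintro ⟨a, ha, b, hb, hab, rfl⟩
        refine ⟨{a, b}, ⟨?_, Finset.card_pair hab⟩, Finset.sum_pair hab⟩
        intro t ht
        simp only [Finset.mem_insert, Finset.mem_singleton] at ht
        rcases ht with rfl | rfl <;> assumption
    ext ⟨z, c⟩
    rw [key, hz]
    simp only [Finset.mem_sdiff, Finset.mem_product, Finset.mem_univ, true_and,
      Finset.mem_insert, Finset.mem_singleton]
    constructor
    · rintro ⟨⟨x, a⟩, ha, ⟨y, b⟩, hb, hab, h⟩
      rw [hmem] at ha hb
      obtain ⟨h1, h2⟩ := Prod.mk.inj h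
      have hne : a = b → z ≠ 0 := by
        rintro rfl hz0
        exact hab (by rw [hneg x y (h1.trans hz0)])
      rcases ha with rfl | rfl <;> rcases hb with rfl | rfl
      · have := hne rfl
        simp at h2
        simp [← h2, this]
      · simp at h2
        simp [← h2, h12]
      · simp at h2
        simp [← h2, h12]
      · have := hne rfl
        rw [one_add_one_eq_two] at h2
        simp [← h2, this]
    · rintro ⟨hc, hn⟩
      rcases hc with rfl | rfl | rfl
      · refine ⟨(0, 0), by simp [hmem], (z, 0), by simp [hmem], ?_, by simp⟩
        intro h
        exact hn ⟨(Prod.mk.inj h).1.symm, by simp⟩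
      · refine ⟨(0, 0), by simp [hmem], (z, 1), by simp [hmem], ?_, by simp⟩
        intro h
        exact h01 (Prod.mk.inj h).2
      · refine ⟨(0, 1), by simp [hmem], (z, 1), by simp [hmem], ?_, by simp [one_add_one_eq_two]⟩
        intro h
        exact hn ⟨(Prod.mk.inj h).1.symm, by simp⟩
  have hC : (hFoldRSum 2 A).card = 3 * 2 ^ k - 2 := by
    rw [hS, Finset.card_sdiff_of_subset, Finset.card_product, Finset.card_product,
      Finset.card_pair h02, Finset.card_eq_three.2 ⟨0, 1, 2, h01, h02, h12, rfl⟩]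
    · simp [ZMod.card, mul_comm]
    · apply Finset.product_subset_product (Finset.subset_univ _)
      intro t
      simp only [Finset.mem_insert, Finset.mem_singleton]
      tauto
  refine ⟨?_, ?_, hS, hC, ?_⟩
  · rw [hA, Finset.card_product, Finset.card_pair h01]
    simp [ZMod.card, pow_succ]
  · rw [eq_top_iff]
    rintro ⟨x, c⟩ -
    have e : ((x, c) : (Fin k → ZMod 2) × ZMod d) = (x, 0) + c.val • (0, 1) := by
      ext <;> simp
    rw [e]
    refine add_mem (AddSubgroup.subset_closure ?_)
      (nsmul_mem (AddSubgroup.subset_closure ?_) _)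
    · exact Finset.mem_coe.2 ((hmem _ _).2 (Or.inl rfl))
    · exact Finset.mem_coe.2 ((hmem _ _).2 (Or.inr rfl))
  · have hp : 1 ≤ 2 ^ k := Nat.one_le_two_pow
    rw [hC, Nat.cast_sub (by omega)]
    push_cast
    have hd' : (3 : ℚ) ≤ d := by exact_mod_cast hd
    have hp' : (0 : ℚ) < 2 ^ k := by positivity
    rw [lt_min_iff, pow_succ]
    constructor
    · nlinarith
    · linarith
end

section
/- Let p be an odd prime and t ≥ 2 an integer; set n = p^t, G = Z_n, and m = p^{t−1} + 1. Then ρ(G, m, 2) = 2m − 1 and ρ^(G, m, 2) ≤ 2m − 3; in particular ρ^(G, m, 2) ≠ min{ρ(G, m, 2), 2m − 2}, contradicting Plagne's conjecture for exceptional m. -/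
open Finset

open scoped Pointwise in
theorem mann_aux {p t : ℕ} (hp : p.Prime) (ht : 1 ≤ t) {G : Type*} [AddCommGroup G] [Fintype G]
    [DecidableEq G] (hG : Fintype.card G = p ^ t) (S T : Finset G)
    (hS : p ^ (t - 1) + 1 ≤ S.card) (hT : T.Nonempty) (hne : S + T ≠ univ) :
    T.card + p ^ (t - 1) ≤ (S + T).card := by
  have hSne : S.Nonempty := card_pos.1 (by omega)
  have hle : ∀ X : Finset G, X.card ≤ (S + X).card := fun X => card_le_card_add_left hSne
  -- the key function: lexicographic minimisation
  set N := Fintype.card G with hN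
  set P : Finset (Finset G) := univ.filter (fun X => X.Nonempty ∧ S + X ≠ univ) with hP
  have hTP : T ∈ P := by simp [hP, hT, hne]
  obtain ⟨X, hXP, hX⟩ := exists_min_image P
    (fun X => ((S + X).card - X.card) * (N + 1) + X.card) ⟨T, hTP⟩
  have hcN : ∀ X : Finset G, X.card ≤ N := fun X => card_le_univ X
  have hX1 : ∀ Y ∈ P, (S + X).card - X.card ≤ (S + Y).card - Y.card := by
    intro Y hY
    have h := hX Y hY
    have := hcN Y
    by_contra! hlt
    have : ((S + Y).card - Y.card + 1) * (N + 1) ≤ ((S + X).card - X.card) * (N + 1) :=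
      Nat.mul_le_mul_right _ hlt
    nlinarith
  have hX2 : ∀ Y ∈ P, (S + Y).card - Y.card ≤ (S + X).card - X.card → X.card ≤ Y.card := by
    intro Y hY hYX
    have h := hX Y hY
    have he := le_antisymm (hX1 Y hY) hYX
    simp only [he] at h
    omega
  have hXne : X.Nonempty := (mem_filter.1 hXP).2.1
  have hXu : S + X ≠ univ := (mem_filter.1 hXP).2.2
  -- duality
  have hdual : X.card + (S + X).card ≤ N := by
    have hX'card : (-(S + X)ᶜ).card = N - (S + X).card := by
      rw [card_neg, card_compl]
    have hsub : S + -(S + X)ᶜ ⊆ -(Xᶜ) := by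
      intro z hz
      obtain ⟨s, hs, w, hw, rfl⟩ := mem_add.1 hz
      rw [mem_neg'] at hw ⊢
      rw [mem_compl] at hw ⊢
      intro hx
      apply hw
      have := add_mem_add hs hx
      simpa using this
    have hc : (-(Xᶜ)).card = N - X.card := by rw [card_neg, card_compl]
    have hle' := card_le_card hsub
    have hXpos := hXne.card_pos
    have hlt : (S + X).card < N := by
      rw [hN]; exact card_lt_univ_of_notMem (by
        simpa using (Classical.choose_spec (not_forall.1 (fun h => hXu (eq_univ_iff_forall.2 h)))))
    have hmem : -(S + X)ᶜ ∈ P := by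
      rw [hP, mem_filter]
      refine ⟨mem_univ _, card_pos.1 (by omega), fun h => ?_⟩
      rw [h, card_univ] at hle'
      have := hcN X
      omega
    have := hX2 _ hmem (by have := hle X; omega)
    omega
  -- translates
  have htr : ∀ d : G, (X ∩ ({d} + X)).Nonempty → {d} + X = X := by
    intro d hd
    set Y := ({d} + X : Finset G) with hY
    have hYc : Y.card = X.card := by rw [hY, singleton_add, card_vadd_finset]
    have hSY : S + Y = {d} + (S + X) := by rw [hY, add_left_comm]
    have hSYc : (S + Y).card = (S + X).card := by
      rw [hSY, singleton_add, card_vadd_finset]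
    have hu : S + (X ∪ Y) = (S + X) ∪ (S + Y) := add_union
    have hi : S + (X ∩ Y) ⊆ (S + X) ∩ (S + Y) := add_inter_subset
    have c1 := card_union_add_card_inter X Y
    have c2 := card_union_add_card_inter (S + X) (S + Y)
    have c3 := card_le_card hi
    have c4 := hle X
    have c5 := hle (X ∩ Y)
    have c6 := hle (X ∪ Y)
    have c7 := hd.card_pos
    have hIP : X ∩ Y ∈ P := by
      rw [hP, mem_filter]
      refine ⟨mem_univ _, hd, fun h => hXu ?_⟩
      rw [h] at hi
      exact univ_subset_iff.1 (hi.trans inter_subset_left)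
    have hcard : X.card ≤ (X ∩ Y).card := by
      by_cases hun : S + (X ∪ Y) = univ
      · have h1 := hX1 _ hIP
        rw [← hu, hun, card_univ] at c2
        omega
      · have hUP : X ∪ Y ∈ P := by
          rw [hP, mem_filter]
          exact ⟨mem_univ _, hXne.mono subset_union_left, hun⟩
        have h1 := hX1 _ hUP
        rw [hu] at h1 c6
        exact hX2 _ hIP (by omega)
    have e1 : X ∩ Y = X := eq_of_subset_of_card_le inter_subset_left hcard
    have e2 : X ∩ Y = Y := eq_of_subset_of_card_le inter_subset_right (by omega)
    rw [← e2, e1]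
  have hdiff : ∀ x ∈ X, ∀ y ∈ X, ∀ z ∈ X, x - y + z ∈ X := by
    intro x hx y hy z hz
    have : {x - y} + X = X := htr _ ⟨x, mem_inter.2 ⟨hx, by
      rw [mem_add]; exact ⟨x - y, by simp, y, hy, by simp⟩⟩⟩
    rw [← this]
    exact add_mem_add (by simp) hz
  obtain ⟨x0, hx0⟩ := hXne
  let H : AddSubgroup G :=
    { carrier := {g | g + x0 ∈ X}
      zero_mem' := by simpa using hx0
      add_mem' := by
        intro a b ha hb
        have := hdiff _ ha _ hx0 _ hb
        simpa [add_assoc] using this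
      neg_mem' := by
        intro a ha
        have := hdiff _ hx0 _ ha _ hx0
        simpa using this }
  have hHc : Nat.card H = X.card := by
    rw [← Fintype.card_coe X, ← Nat.card_eq_fintype_card]
    refine Nat.card_congr
      { toFun := fun g => ⟨g.1 + x0, g.2⟩
        invFun := fun x => ⟨x.1 - x0, by
          change x.1 - x0 + x0 ∈ X
          rw [sub_add_cancel]; exact x.2⟩
        left_inv := fun g => by simp
        right_inv := fun x => by simp }
  have hdvd : X.card ∣ p ^ t := by
    rw [← hHc, ← hG, hN, ← Nat.card_eq_fintype_card]; exact H.card_addSubgroup_dvd_card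
  have hdvd2 : X.card ∣ (S + X).card := by
    rw [add_comm]
    apply card_dvd_card_add_left
    rintro _ ⟨b, hb, rfl⟩ _ ⟨c, hc, rfl⟩ hbc
    by_contra hnd
    apply hbc
    obtain ⟨z, hz1, hz2⟩ := not_disjoint_iff.1 hnd
    simp only [id, mem_image] at hz1 hz2
    obtain ⟨x, hx, rfl⟩ := hz1
    obtain ⟨y, hy, hyx⟩ := hz2
    ext w
    simp only [mem_image]
    constructor
    · rintro ⟨a, ha, rfl⟩
      refine ⟨y - x + a, hdiff _ hy _ hx _ ha, ?_⟩
      have : y = x + b - c := eq_sub_of_add_eq hyx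
      rw [this]; abel
    · rintro ⟨a, ha, rfl⟩
      refine ⟨x - y + a, hdiff _ hx _ hy _ ha, ?_⟩
      have : y = x + b - c := eq_sub_of_add_eq hyx
      rw [this]; abel
  obtain ⟨s, hs, hXs⟩ := (Nat.dvd_prime_pow hp).1 hdvd
  have hst : s ≠ t := by
    rintro rfl
    have h1 := hle X
    have : 0 < X.card := card_pos.2 ⟨_, hx0⟩
    omega
  have hdq : X.card ∣ p ^ (t - 1) := hXs ▸ pow_dvd_pow p (by omega)
  have hSX : S.card ≤ (S + X).card := card_le_card_add_right ⟨_, hx0⟩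
  have hkey : p ^ (t - 1) + X.card ≤ (S + X).card := by
    obtain ⟨a, ha⟩ := hdq
    obtain ⟨b, hb⟩ := hdvd2
    rw [ha] at hS ⊢
    rw [hb] at hSX ⊢
    have : a < b := by
      by_contra! h
      have := Nat.mul_le_mul_left X.card h
      omega
    calc X.card * a + X.card = X.card * (a + 1) := by ring
      _ ≤ _ := Nat.mul_le_mul_left _ this
  have := hX1 T hTP
  have := hle T
  omega

theorem hFoldSum_two {G : Type*} [AddCommMonoid G] [DecidableEq G] (A : Finset G) :
    hFoldSum 2 A = Finset.image₂ (· + ·) A A := by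
  ext z
  simp only [hFoldSum, mem_image, Fintype.mem_piFinset, Fin.sum_univ_two, mem_image₂]
  constructor
  · rintro ⟨f, hf, rfl⟩
    exact ⟨f 0, hf 0, f 1, hf 1, rfl⟩
  · rintro ⟨a, ha, b, hb, rfl⟩
    refine ⟨![a, b], ?_, by simp⟩
    intro i
    fin_cases i <;> simpa

theorem stmt13 (p t : ℕ) (hp : p.Prime) (hodd : Odd p) (ht : 2 ≤ t) :
    rho (ZMod (p ^ t)) (p ^ (t - 1) + 1) 2 = 2 * (p ^ (t - 1) + 1) - 1 ∧
    rhoHat (ZMod (p ^ t)) (p ^ (t - 1) + 1) 2 ≤ 2 * (p ^ (t - 1) + 1) - 3 ∧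
    rhoHat (ZMod (p ^ t)) (p ^ (t - 1) + 1) 2 ≠
      min (rho (ZMod (p ^ t)) (p ^ (t - 1) + 1) 2) (2 * (p ^ (t - 1) + 1) - 2) := by
  have hp3 : 3 ≤ p := by
    have := hp.two_le
    rcases hodd with ⟨k, hk⟩
    omega
  have hpt : p ^ t = p ^ (t - 1) * p := by
    rw [← pow_succ]; congr 1; omega
  have hqpos : 0 < p ^ (t - 1) := pow_pos (by omega) _
  have hn : 3 * p ^ (t - 1) ≤ p ^ t := by rw [hpt]; nlinarith
  have : NeZero (p ^ t) := ⟨by omega⟩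
  have hlow : ∀ A : Finset (ZMod (p ^ t)), A.card = p ^ (t - 1) + 1 →
      2 * (p ^ (t - 1) + 1) - 1 ≤ (hFoldSum 2 A).card := by
    intro A hA
    rw [hFoldSum_two]
    by_cases h : Finset.image₂ (· + ·) A A = univ
    · rw [h, card_univ, ZMod.card]; omega
    · have := mann_aux hp (by omega) (ZMod.card (p ^ t)) A A hA.ge
        (card_pos.1 (by omega)) h
      change _ ≤ (Finset.image₂ (· + ·) A A).card at this
      omega
  set A : Finset (ZMod (p ^ t)) := (range (p ^ (t - 1) + 1)).image (fun i : ℕ => (i : ZMod (p ^ t)))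
    with hAdef
  have hAc : A.card = p ^ (t - 1) + 1 := by
    rw [hAdef, card_image_of_injOn, card_range]
    intro a ha b hb hab
    have ha' := mem_range.1 (mem_coe.1 ha)
    have hb' := mem_range.1 (mem_coe.1 hb)
    have := (ZMod.natCast_eq_natCast_iff' _ _ _).1 hab
    rwa [Nat.mod_eq_of_lt (by omega), Nat.mod_eq_of_lt (by omega)] at this
  have hup : (hFoldSum 2 A).card ≤ 2 * (p ^ (t - 1) + 1) - 1 := by
    have : hFoldSum 2 A ⊆ (range (2 * (p ^ (t - 1) + 1) - 1)).image
        (fun i : ℕ => (i : ZMod (p ^ t))) := by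
      rw [hFoldSum_two]
      intro z hz
      simp only [hAdef, mem_image₂, mem_image, mem_range] at hz ⊢
      obtain ⟨_, ⟨a, ha, rfl⟩, _, ⟨b, hb, rfl⟩, rfl⟩ := hz
      exact ⟨a + b, by omega, by push_cast; rfl⟩
    simpa using (card_le_card this).trans card_image_le
  have hupR : (hFoldRSum 2 A).card ≤ 2 * (p ^ (t - 1) + 1) - 3 := by
    have : hFoldRSum 2 A ⊆ (Ico 1 (2 * (p ^ (t - 1) + 1) - 2)).image
        (fun i : ℕ => (i : ZMod (p ^ t))) := by
      intro z hz
      simp only [hFoldRSum, mem_image, mem_powersetCard] at hz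
      obtain ⟨s, ⟨hs, hs2⟩, rfl⟩ := hz
      obtain ⟨x, y, hxy, rfl⟩ := card_eq_two.1 hs2
      have hx := hs (mem_insert_self x _)
      have hy := hs (mem_insert_of_mem (mem_singleton_self y))
      simp only [hAdef, mem_image, mem_range] at hx hy
      obtain ⟨a, ha, rfl⟩ := hx
      obtain ⟨b, hb, rfl⟩ := hy
      rw [sum_pair hxy, mem_image]
      have : a ≠ b := fun h => hxy (by rw [h])
      exact ⟨a + b, by rw [mem_Ico]; omega, by push_cast; rfl⟩
    have h := (card_le_card this).trans card_image_le
    rw [Nat.card_Ico] at h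
    omega
  have h1 : rho (ZMod (p ^ t)) (p ^ (t - 1) + 1) 2 = 2 * (p ^ (t - 1) + 1) - 1 := by
    apply le_antisymm
    · have h : rho (ZMod (p ^ t)) (p ^ (t - 1) + 1) 2 ≤ (hFoldSum 2 A).card :=
        Nat.sInf_le ⟨A, hAc, rfl⟩
      exact h.trans hup
    · unfold rho
      refine le_csInf ⟨(hFoldSum 2 A).card, A, hAc, rfl⟩ ?_
      rintro k ⟨B, hB, rfl⟩
      exact hlow B hB
  have h2 : rhoHat (ZMod (p ^ t)) (p ^ (t - 1) + 1) 2 ≤ 2 * (p ^ (t - 1) + 1) - 3 :=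
    le_trans (Nat.sInf_le ⟨A, hAc, rfl⟩ : rhoHat (ZMod (p ^ t)) (p ^ (t - 1) + 1) 2 ≤ (hFoldRSum 2 A).card) hupR
  refine ⟨h1, h2, ?_⟩
  rw [h1]
  omega
end
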